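/- arXiv:1603.02911 — 5 statements merged into one kernel-verified Lean document; each statement's English description precedes it below -/
import Mathlib

section
/- Assume the Riemann Hypothesis. Then for every real t* with Ξ'(t*) = 0 and Ξ(t*) ≠ 0, one has Ξ''(t*)·Ξ(t*) < 0 (equivalently, Ξ''(t*)/Ξ(t*) < 0 at every such critical point of Ξ). -/
open Complex

/-- Riemann's xi function: `ξ(s) = s(s-1)/2 · Λ(s)` where `Λ` is the completed zeta. -/
noncomputable def xi (s : ℂ) : ℂ := s * (s - 1) / 2 * completedRiemannZeta s

/-- `Ξ(t) = Re ξ(1/2 + it)` for real `t`. -/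
noncomputable def Xi (t : ℝ) : ℝ := (xi (1 / 2 + t * I)).re

open Filter Topology ComplexConjugate

/-! ### The entire xi function -/

/-- The entire version of `xi`; it differs from `xi` only at `0` and `1`. -/
noncomputable def entireXi (s : ℂ) : ℂ := s * (s - 1) / 2 * completedRiemannZeta₀ s + 1 / 2

lemma differentiable_entireXi : Differentiable ℂ entireXi := by
  have := differentiable_completedZeta₀
  unfold entireXi
  fun_prop

lemma entireXi_eq_xi {s : ℂ} (h0 : s ≠ 0) (h1 : s ≠ 1) : entireXi s = xi s := by
  have h1' : 1 - s ≠ 0 := sub_ne_zero.mpr h1.symm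
  rw [entireXi, xi, completedRiemannZeta_eq]
  field_simp
  ring

lemma entireXi_one : entireXi 1 = 1 / 2 := by simp [entireXi]

lemma entireXi_zero : entireXi 0 = 1 / 2 := by simp [entireXi]

lemma entireXi_one_sub (s : ℂ) : entireXi (1 - s) = entireXi s := by
  rw [entireXi, entireXi, completedRiemannZeta₀_one_sub]
  ring

lemma entireXi_eq_mul_riemannZeta {s : ℂ} (h0 : 0 < s.re) (h1 : s ≠ 1) :
    entireXi s = s * (s - 1) / 2 * (Gammaℝ s * riemannZeta s) := by
  have hs : s ≠ 0 := by rintro rfl; simp at h0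
  rw [entireXi_eq_xi hs h1, xi, riemannZeta_def_of_ne_zero hs,
    mul_div_cancel₀ _ (Gammaℝ_ne_zero_of_re_pos h0)]

lemma Complex.Gammaℝ_conj (s : ℂ) : Gammaℝ (conj s) = conj (Gammaℝ s) := by
  have hpi : (Real.pi : ℂ).arg ≠ Real.pi := by
    rw [Complex.arg_ofReal_of_nonneg Real.pi_pos.le]
    exact Real.pi_pos.ne
  have h1 : -conj s / 2 = conj (-s / 2) := by simp [map_ofNat]
  have h2 : conj s / 2 = conj (s / 2) := by simp [map_ofNat]
  rw [Gammaℝ_def, Gammaℝ_def, map_mul, ← Complex.Gamma_conj, h1, h2, Complex.cpow_conj _ _ hpi,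
    Complex.conj_ofReal]

lemma entireXi_conj {s : ℂ} (h0 : 0 < s.re) : entireXi (conj s) = conj (entireXi s) := by
  rcases eq_or_ne s 1 with rfl | h1
  · simp [entireXi_one, map_ofNat]
  · have h1' : conj s ≠ 1 := by
      intro h
      apply h1
      simpa using congrArg conj h
    rw [entireXi_eq_mul_riemannZeta h0 h1, entireXi_eq_mul_riemannZeta (by simpa using h0) h1',
      Gammaℝ_conj, riemannZeta_conj]
    simp [map_ofNat]

/-- Reflection of `entireXi` in the critical line. -/
lemma entireXi_one_sub_conj {s : ℂ} (h0 : 0 < s.re) :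
    entireXi (1 - conj s) = conj (entireXi s) := by
  rw [entireXi_one_sub, entireXi_conj h0]

lemma entireXi_ne_zero_of_one_half_lt_re (hRH : RiemannHypothesis) {s : ℂ} (hs : 1 / 2 < s.re) :
    entireXi s ≠ 0 := by
  have h0 : 0 < s.re := by linarith
  rcases eq_or_ne s 1 with rfl | h1
  · simp [entireXi_one]
  · have hs0 : s ≠ 0 := by rintro rfl; simp at h0
    rw [entireXi_eq_mul_riemannZeta h0 h1]
    refine mul_ne_zero (by simp [hs0, sub_ne_zero.mpr h1])
      (mul_ne_zero (Gammaℝ_ne_zero_of_re_pos h0) fun hz ↦ ?_)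
    have := hRH s hz ?_ h1
    · linarith
    · rintro ⟨n, rfl⟩
      have : (0 : ℝ) ≤ n := n.cast_nonneg
      simp at h0
      linarith

lemma entireXi_two : entireXi 2 = Real.pi / 6 := by
  rw [entireXi_eq_mul_riemannZeta (by simp) (by norm_num), riemannZeta_two, Gammaℝ_def]
  have : (-2 / 2 : ℂ) = -1 := by norm_num
  rw [this, Complex.cpow_neg_one]
  have : (Real.pi : ℂ) ≠ 0 := by exact_mod_cast Real.pi_ne_zero
  norm_num
  field_simp

/-! ### Upper bounds in vertical strips -/

lemma exists_norm_completedRiemannZeta₀_le (a b : ℝ) :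
    ∃ C, ∀ s : ℂ, a ≤ s.re → s.re ≤ b → ‖completedRiemannZeta₀ s‖ ≤ C := by
  set P := HurwitzZeta.hurwitzEvenFEPair 0
  have hconv (s : ℂ) : MellinConvergent P.f_modif s :=
    (P.isStrongFEPair_toStrongFEPair.hasMellin s).1
  have ha := (hconv (a / 2 : ℝ)).norm
  have hb := (hconv (b / 2 : ℝ)).norm
  refine ⟨(∫ t in Set.Ioi (0 : ℝ), (‖(t : ℂ) ^ (((a / 2 : ℝ) : ℂ) - 1) • P.f_modif t‖ +
    ‖(t : ℂ) ^ (((b / 2 : ℝ) : ℂ) - 1) • P.f_modif t‖)) / 2, fun s hsa hsb ↦ ?_⟩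
  have hs : completedRiemannZeta₀ s = mellin P.f_modif (s / 2) / 2 := rfl
  rw [hs, norm_div, Complex.norm_ofNat]
  gcongr
  refine (MeasureTheory.norm_integral_le_integral_norm _).trans ?_
  refine MeasureTheory.setIntegral_mono_on (hconv (s / 2)).norm (ha.add hb) measurableSet_Ioi ?_
  intro t (ht : 0 < t)
  have hre : (s / 2 - 1).re = s.re / 2 - 1 := by simp
  simp only [norm_smul, Complex.norm_cpow_eq_rpow_re_of_pos ht, hre, Complex.sub_re,
    Complex.ofReal_re, Complex.one_re]
  rw [← add_mul]
  gcongr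
  rcases le_total t 1 with h1 | h1
  · have := Real.rpow_le_rpow_of_exponent_ge ht h1 (by linarith : a / 2 - 1 ≤ s.re / 2 - 1)
    have := Real.rpow_nonneg ht.le (b / 2 - 1)
    linarith
  · have := Real.rpow_le_rpow_of_exponent_le h1 (by linarith : s.re / 2 - 1 ≤ b / 2 - 1)
    have := Real.rpow_nonneg ht.le (a / 2 - 1)
    linarith

lemma exists_norm_entireXi_le :
    ∃ A > 0, ∀ s : ℂ, 0 ≤ s.re → s.re ≤ 6 → ‖entireXi s‖ ≤ Real.exp (A * (1 + |s.im|)) := by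
  obtain ⟨C, hC⟩ := exists_norm_completedRiemannZeta₀_le 0 6
  have hC0 : 0 ≤ C := (norm_nonneg _).trans (hC 0 (by simp) (by simp))
  refine ⟨50 * C + 20, by positivity, fun s h0 h6 ↦ ?_⟩
  set y := |s.im|
  have hy : 0 ≤ y := abs_nonneg _
  have hs : ‖s‖ ≤ 7 * (1 + y) := by
    have := Complex.norm_le_abs_re_add_abs_im s
    rw [abs_of_nonneg h0] at this
    linarith
  have hs1 : ‖s - 1‖ ≤ 8 * (1 + y) := by
    have := norm_sub_le s 1
    rw [norm_one] at this
    linarith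
  have h1 : ‖entireXi s‖ ≤ 7 * (1 + y) * (8 * (1 + y)) / 2 * C + 1 / 2 := by
    unfold entireXi
    refine (norm_add_le _ _).trans ?_
    rw [norm_mul, norm_div, norm_mul, Complex.norm_ofNat]
    have := hC s h0 h6
    gcongr
    simp
  have h2 := Real.add_one_le_exp (28 * C)
  have h3 := Real.add_one_le_exp (1 + y)
  calc ‖entireXi s‖ ≤ (28 * C + 1) * (1 + y) ^ 2 := by nlinarith
    _ ≤ Real.exp (28 * C) * Real.exp (1 + y) ^ 2 := by gcongr; linarith
    _ = Real.exp (28 * C + 2 * (1 + y)) := by rw [← Real.exp_nat_mul, ← Real.exp_add]; simp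
    _ ≤ _ := by
      gcongr
      nlinarith [mul_nonneg hC0 hy]

/-! ### Bounds for zeta and Gamma -/

lemma exists_norm_riemannZeta_le :
    ∃ K > 0, ∀ s : ℂ, 2 ≤ s.re → ‖riemannZeta s‖ ≤ K ∧ ‖(riemannZeta s)⁻¹‖ ≤ K := by
  have hsum : Summable fun n ↦ ‖LSeries.term 1 2 n‖ :=
    ((LSeriesSummable_one_iff (s := 2)).mpr (by simp)).norm
  have key (f : ℕ → ℂ) (hf : ∀ n, ‖f n‖ ≤ 1) (s : ℂ) (hs : 2 ≤ s.re) :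
      ‖LSeries f s‖ ≤ ∑' n, ‖LSeries.term 1 2 n‖ := by
    refine tsum_of_norm_bounded hsum.hasSum fun n ↦ ?_
    refine (LSeries.norm_term_le (g := 1) s (by simpa using hf n)).trans ?_
    exact LSeries.norm_term_le_of_re_le_re 1 (by simpa using hs) n
  refine ⟨(∑' n, ‖LSeries.term 1 2 n‖) + 1, by positivity, fun s hs ↦ ?_⟩
  have hs1 : 1 < s.re := by linarith
  have hz := ArithmeticFunction.LSeries_zeta_mul_Lseries_moebius hs1
  rw [ArithmeticFunction.LSeries_zeta_eq_riemannZeta hs1] at hz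
  constructor
  · rw [← LSeries_one_eq_riemannZeta hs1]
    have := key 1 (by simp) s hs
    linarith
  · rw [inv_eq_of_mul_eq_one_right hz]
    have := key (fun n ↦ (ArithmeticFunction.moebius n : ℂ)) (fun n ↦ ?_) s hs
    · linarith
    · rw [Complex.norm_intCast]
      exact_mod_cast ArithmeticFunction.abs_moebius_le_one

lemma norm_Gamma_le_mul_norm_Gamma_add {h : ℝ} (hh : 0 < h) {z : ℂ} (hz : 1 ≤ z.re) :
    ‖Gamma z‖ ≤ 1 / h / Real.Gamma h * ‖Gamma (z + h)‖ := by
  have hG := Real.Gamma_pos_of_pos hh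
  have hmul := Complex.Gamma_mul_Gamma_eq_betaIntegral (s := z) (t := h) (by linarith) (by simpa)
  have hβ : ‖betaIntegral z h‖ ≤ 1 / h := by
    have hconv := (betaIntegral_convergent (u := 1) (v := h) (by simp) (by simpa)).norm
    have heval : betaIntegral 1 h = 1 / h := by
      rw [betaIntegral_symm, betaIntegral_eval_one_right (by simpa)]
    have hval : ∫ x in (0 : ℝ)..1, (1 - x) ^ (h - 1) = 1 / h := by
      rw [intervalIntegral.integral_comp_sub_left (fun x ↦ x ^ (h - 1)) 1,
        integral_rpow (Or.inl (by linarith))]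
      simp [Real.zero_rpow hh.ne']
    rw [← hval]
    refine intervalIntegral.norm_integral_le_of_norm_le zero_le_one ?_ ?_
    · have hne : ∀ᵐ x : ℝ, x ≠ 1 := by simp [MeasureTheory.ae_iff, MeasureTheory.measure_singleton]
      filter_upwards [hne] with x hx1 hx
      have hx0 : 0 < x := hx.1
      have hx1' : 0 < 1 - x := sub_pos.mpr (lt_of_le_of_ne hx.2 hx1)
      have : (1 - (x : ℂ)) = ((1 - x : ℝ) : ℂ) := by push_cast; rfl
      rw [norm_mul, this, Complex.norm_cpow_eq_rpow_re_of_pos hx0,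
        Complex.norm_cpow_eq_rpow_re_of_pos hx1']
      simp only [Complex.sub_re, Complex.one_re, Complex.ofReal_re]
      have := Real.rpow_le_one hx0.le hx.2 (by linarith : 0 ≤ z.re - 1)
      have h2 := Real.rpow_nonneg hx1'.le (h - 1)
      exact mul_le_of_le_one_left h2 this
    · have h1 := intervalIntegral.intervalIntegrable_rpow' (a := 0) (b := 1)
        (by linarith : -1 < h - 1)
      simpa using (h1.comp_sub_left 1).symm
  have h2 : ‖Gamma (h : ℂ)‖ = Real.Gamma h := by
    rw [Complex.Gamma_ofReal, Complex.norm_real, Real.norm_of_nonneg hG.le]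
  have h3 : ‖Gamma z‖ * Real.Gamma h ≤ ‖Gamma (z + h)‖ * (1 / h) := by
    rw [← h2, ← norm_mul, hmul, norm_mul]
    gcongr
  rw [div_mul_eq_mul_div, le_div_iff₀ hG]
  linarith

lemma exp_neg_le_norm_Gamma_three_halves (y : ℝ) :
    Real.exp (-(2 * (1 + |y|))) ≤ ‖Gamma (3 / 2 + y * I)‖ := by
  set w : ℂ := 1 / 2 + y * I with hw
  have hwre : w.re = 1 / 2 := by simp [hw]
  have hw0 : w ≠ 0 := by
    intro h
    simp [h] at hwre
  have h1 : Gamma (3 / 2 + y * I) = w * Gamma w := by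
    rw [← Complex.Gamma_add_one w hw0]
    congr 1
    rw [hw]
    ring
  have h2 : 1 - w = conj w := by
    rw [hw]
    apply Complex.ext
    · simp
      norm_num
    · simp
  have hrefl := congrArg norm (Complex.Gamma_mul_Gamma_one_sub w)
  rw [h2, Complex.Gamma_conj, norm_mul, RCLike.norm_conj, norm_div, Complex.norm_real,
    Real.norm_of_nonneg Real.pi_pos.le] at hrefl
  have hsin : ‖sin (Real.pi * w)‖ ≤ Real.exp (Real.pi * |y|) := by
    have e1 : (-(Real.pi * w) * I).re = Real.pi * y := by simp [hw]
    have e2 : (Real.pi * w * I).re = -(Real.pi * y) := by simp [hw]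
    rw [Complex.sin, norm_div, norm_mul, Complex.norm_I, mul_one, Complex.norm_ofNat,
      div_le_iff₀ two_pos]
    refine (norm_sub_le _ _).trans ?_
    rw [Complex.norm_exp, Complex.norm_exp, e1, e2]
    have := Real.exp_le_exp.mpr (mul_le_mul_of_nonneg_left (le_abs_self y) Real.pi_pos.le)
    have := Real.exp_le_exp.mpr (mul_le_mul_of_nonneg_left (neg_abs_le y) Real.pi_pos.le)
    have h5 : Real.exp (-(Real.pi * y)) ≤ Real.exp (Real.pi * |y|) := by
      apply Real.exp_le_exp.mpr
      nlinarith [neg_abs_le y, Real.pi_pos]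
    linarith
  have hsin0 : 0 < ‖sin (Real.pi * w)‖ := by
    rw [norm_pos_iff]
    intro h0
    have hw' : Gamma w ≠ 0 := Complex.Gamma_ne_zero_of_re_pos (by rw [hwre]; norm_num)
    rw [h0, norm_zero, div_zero] at hrefl
    have := norm_pos_iff.mpr hw'
    nlinarith
  have hGsq : Real.exp (-(2 * (1 + |y|))) ^ 2 ≤ ‖Gamma (3 / 2 + y * I)‖ ^ 2 := by
    have hwn : 1 / 2 ≤ ‖w‖ := by
      have := Complex.abs_re_le_norm w
      rw [hwre] at this
      exact (le_abs_self _).trans this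
    have hlow : Real.pi * Real.exp (-(Real.pi * |y|)) ≤ ‖Gamma w‖ * ‖Gamma w‖ := by
      rw [hrefl, Real.exp_neg, ← div_eq_mul_inv]
      gcongr
    have hsmall : Real.exp (-(2 * (1 + |y|))) ^ 2 ≤ 1 / 4 * Real.exp (-(Real.pi * |y|)) := by
      have : Real.exp (-(2 * (1 + |y|))) ^ 2 = Real.exp (-4) * Real.exp (-(4 * |y|)) := by
        rw [← Real.exp_nat_mul, ← Real.exp_add]
        congr 1
        push_cast
        ring
      rw [this]
      have h4 : Real.exp (-4) ≤ 1 / 4 := by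
        rw [Real.exp_neg, one_div]
        gcongr
        have := Real.add_one_le_exp (4 : ℝ)
        linarith
      gcongr
      exact Real.pi_le_four
    have hpi : Real.exp (-(Real.pi * |y|)) ≤ Real.pi * Real.exp (-(Real.pi * |y|)) :=
      le_mul_of_one_le_left (Real.exp_pos _).le (by linarith [Real.pi_gt_three])
    rw [h1, norm_mul, mul_pow]
    have : (1 / 4 : ℝ) ≤ ‖w‖ ^ 2 := by nlinarith
    calc _ ≤ _ := hsmall
      _ ≤ ‖w‖ ^ 2 * (‖Gamma w‖ * ‖Gamma w‖) := by gcongr; linarith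
      _ = _ := by ring
  exact (sq_le_sq₀ (Real.exp_pos _).le (norm_nonneg _)).mp hGsq

lemma exists_exp_neg_le_norm_entireXi_three_add :
    ∃ A > 0, ∀ t : ℝ, Real.exp (-(A * (1 + |t|))) ≤ ‖entireXi (3 + t * I)‖ := by
  obtain ⟨K, hK, hζ⟩ := exists_norm_riemannZeta_le
  have hc : 0 < Real.pi ^ (-3 / 2 : ℝ) / K := by positivity
  refine ⟨2 + |Real.log (Real.pi ^ (-3 / 2 : ℝ) / K)|, by positivity, fun t ↦ ?_⟩
  set s : ℂ := 3 + t * I with hs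
  have hre : s.re = 3 := by simp [hs]
  have hs1 : s ≠ 1 := by
    intro h
    rw [h] at hre
    norm_num at hre
  rw [entireXi_eq_mul_riemannZeta (by rw [hre]; norm_num) hs1, Gammaℝ_def]
  have e1 : s / 2 = 3 / 2 + (t / 2 : ℝ) * I := by rw [hs]; push_cast; ring
  have hG := exp_neg_le_norm_Gamma_three_halves (t / 2)
  rw [← e1] at hG
  have hz : 1 / K ≤ ‖riemannZeta s‖ := by
    have h1 := (hζ s (by rw [hre]; norm_num)).2
    have h0 := riemannZeta_ne_zero_of_one_le_re (s := s) (by rw [hre]; norm_num)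
    rw [norm_inv] at h1
    exact (one_div_le hK (norm_pos_iff.mpr h0)).mpr (by rwa [one_div])
  have hpoly : 1 ≤ ‖s * (s - 1) / 2‖ := by
    have a1 : 3 ≤ ‖s‖ := by
      have := Complex.re_le_norm s
      rwa [hre] at this
    have a2 : 2 ≤ ‖s - 1‖ := by
      have := Complex.re_le_norm (s - 1)
      rw [Complex.sub_re, hre, Complex.one_re] at this
      linarith
    rw [norm_div, norm_mul, Complex.norm_ofNat]
    nlinarith
  have hpi : ‖(Real.pi : ℂ) ^ (-s / 2)‖ = Real.pi ^ (-3 / 2 : ℝ) := by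
    rw [Complex.norm_cpow_eq_rpow_re_of_pos Real.pi_pos]
    congr 1
    simp [hre]
  rw [norm_mul, norm_mul, norm_mul, hpi]
  have hlog := neg_abs_le (Real.log (Real.pi ^ (-3 / 2 : ℝ) / K))
  have habs : |t / 2| = |t| / 2 := by rw [abs_div, abs_two]
  calc Real.exp (-((2 + |Real.log (Real.pi ^ (-3 / 2 : ℝ) / K)|) * (1 + |t|)))
      ≤ Real.exp (Real.log (Real.pi ^ (-3 / 2 : ℝ) / K) + -(2 * (1 + |t / 2|))) := by
        gcongr
        rw [habs]
        nlinarith [abs_nonneg t, abs_nonneg (Real.log (Real.pi ^ (-3 / 2 : ℝ) / K)),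
          mul_nonneg (abs_nonneg t) (abs_nonneg (Real.log (Real.pi ^ (-3 / 2 : ℝ) / K)))]
    _ = 1 * (Real.pi ^ (-3 / 2 : ℝ) * Real.exp (-(2 * (1 + |t / 2|))) * (1 / K)) := by
        rw [Real.exp_add, Real.exp_log hc]
        ring
    _ ≤ _ := by gcongr

/-! ### Lower bounds for nonvanishing functions -/

lemma exists_eq_mul_exp_of_ne_zero_on_ball {f : ℂ → ℂ} {c : ℂ} {R : ℝ} (hR : 0 < R)
    (hf : DifferentiableOn ℂ f (Metric.ball c R)) (h0 : ∀ z ∈ Metric.ball c R, f z ≠ 0) :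
    ∃ g : ℂ → ℂ, DifferentiableOn ℂ g (Metric.ball c R) ∧ g c = 0 ∧
      ∀ z ∈ Metric.ball c R, f z = f c * exp (g z) := by
  have hlog : DifferentiableOn ℂ (fun z ↦ deriv f z / f z) (Metric.ball c R) :=
    (hf.deriv Metric.isOpen_ball).div hf h0
  obtain ⟨g, hgc, hg⟩ := hlog.isExactOn_ball.with_val_at c 0
  refine ⟨g, fun z hz ↦ (hg z hz).differentiableAt.differentiableWithinAt, hgc, fun z hz ↦ ?_⟩
  have hd (w : ℂ) (hw : w ∈ Metric.ball c R) :
      HasDerivAt (fun w ↦ f w * exp (-g w)) 0 w := by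
    have h1 := (hf.differentiableAt (Metric.isOpen_ball.mem_nhds hw)).hasDerivAt
    refine (h1.mul (hg w hw).neg.cexp).congr_deriv ?_
    field_simp [h0 w hw]
    ring
  have hconst := Metric.isOpen_ball.is_const_of_deriv_eq_zero
    (convex_ball c R).isPreconnected
    (fun w hw ↦ (hd w hw).differentiableAt.differentiableWithinAt)
    (fun w hw ↦ (hd w hw).deriv) hz (Metric.mem_ball_self hR)
  simp only [hgc, neg_zero, Complex.exp_zero, mul_one] at hconst
  rw [← hconst, mul_assoc, ← Complex.exp_add, neg_add_cancel, Complex.exp_zero, mul_one]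

lemma norm_mul_exp_neg_le_of_ne_zero_on_ball {f : ℂ → ℂ} {c z : ℂ} {R r M : ℝ} (hM : 0 < M)
    (hrR : r < R) (hf : DifferentiableOn ℂ f (Metric.ball c R))
    (h0 : ∀ w ∈ Metric.ball c R, f w ≠ 0)
    (hfM : ∀ w ∈ Metric.ball c R, ‖f w‖ ≤ Real.exp M * ‖f c‖) (hz : ‖z - c‖ ≤ r) :
    ‖f c‖ * Real.exp (-(2 * M * r / (R - r))) ≤ ‖f z‖ := by
  have hr : 0 ≤ r := (norm_nonneg _).trans hz
  have hR : 0 < R := hr.trans_lt hrR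
  obtain ⟨g, hg, hgc, hfg⟩ := exists_eq_mul_exp_of_ne_zero_on_ball hR hf h0
  have hfc : 0 < ‖f c‖ := norm_pos_iff.mpr (h0 c (Metric.mem_ball_self hR))
  have hshift {w : ℂ} (hw : w ∈ Metric.ball (0 : ℂ) R) : w + c ∈ Metric.ball c R := by
    simpa [dist_eq_norm] using hw
  have hmaps : Set.MapsTo (fun w ↦ g (w + c)) (Metric.ball 0 R) {w | w.re ≤ M} := by
    intro w hw
    have h1 := hfM _ (hshift hw)
    rw [hfg _ (hshift hw), norm_mul, mul_comm, Complex.norm_exp] at h1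
    exact Real.exp_le_exp.mp (le_of_mul_le_mul_right h1 hfc)
  have hzR : z - c ∈ Metric.ball (0 : ℂ) R := by
    rw [mem_ball_zero_iff]
    exact hz.trans_lt hrR
  have hbc := borelCaratheodory_zero hM
    (hg.comp ((differentiable_id.add_const c).differentiableOn) fun w hw ↦ hshift hw) hmaps hR hzR
    (by simpa using hgc)
  have hz' : z ∈ Metric.ball c R := by simpa using hshift hzR
  simp only [Function.comp_apply, id_eq, sub_add_cancel] at hbc
  have hle : ‖g z‖ ≤ 2 * M * r / (R - r) := by
    refine hbc.trans ?_
    have : 0 < R - r := sub_pos.mpr hrR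
    gcongr
  rw [hfg z hz', norm_mul, Complex.norm_exp]
  gcongr
  have := Complex.abs_re_le_norm (g z)
  have := neg_abs_le (g z).re
  linarith

lemma exists_exp_neg_le_norm_entireXi (hRH : RiemannHypothesis) {h : ℝ} (hh : 0 < h)
    (hh' : h ≤ 3 / 2) : ∃ D, ∀ s : ℂ, 1 / 2 + h ≤ s.re → s.re ≤ 4 →
      Real.exp (-(D * (1 + |s.im|))) ≤ ‖entireXi s‖ := by
  obtain ⟨A, hA, hup⟩ := exists_norm_entireXi_le
  obtain ⟨A', hA', hlow⟩ := exists_exp_neg_le_norm_entireXi_three_add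
  refine ⟨A' + 2 * (4 * A + A') * (5 / 2 - h) / h, fun s hs1 hs2 ↦ ?_⟩
  set t := s.im
  set c : ℂ := 3 + t * I with hc
  have hsc : ‖s - c‖ ≤ 5 / 2 - h := by
    have : s - c = ((s.re - 3 : ℝ) : ℂ) := by
      apply Complex.ext <;> simp [hc, t]
    rw [this, Complex.norm_real, Real.norm_eq_abs, abs_le]
    constructor <;> linarith
  have hball {w : ℂ} (hw : w ∈ Metric.ball c (5 / 2)) :
      1 / 2 < w.re ∧ w.re < 6 ∧ |w.im| ≤ |t| + 5 / 2 := by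
    rw [Metric.mem_ball, dist_eq_norm] at hw
    have h1 := (Complex.abs_re_le_norm (w - c)).trans_lt hw
    have h2 := (Complex.abs_im_le_norm (w - c)).trans_lt hw
    have e1 : (w - c).re = w.re - 3 := by simp [hc]
    have e2 : (w - c).im = w.im - t := by simp [hc]
    rw [e1, abs_lt] at h1
    rw [e2] at h2
    refine ⟨by linarith, by linarith, ?_⟩
    have := abs_sub_abs_le_abs_sub w.im t
    linarith
  have ht : 0 ≤ |t| := abs_nonneg t
  have hM : 0 < (4 * A + A') * (1 + |t|) := by positivity
  have key := norm_mul_exp_neg_le_of_ne_zero_on_ball (f := entireXi) (R := 5 / 2) hM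
    (by linarith) differentiable_entireXi.differentiableOn
    (fun w hw ↦ entireXi_ne_zero_of_one_half_lt_re hRH (hball hw).1)
    (fun w hw ↦ ?_) hsc
  · refine le_trans ?_ key
    calc Real.exp (-((A' + 2 * (4 * A + A') * (5 / 2 - h) / h) * (1 + |t|)))
        = Real.exp (-(A' * (1 + |t|))) * Real.exp (-(2 * ((4 * A + A') * (1 + |t|)) * (5 / 2 - h) /
          (5 / 2 - (5 / 2 - h)))) := by
          rw [← Real.exp_add, sub_sub_cancel]
          congr 1
          ring
      _ ≤ _ := by
          gcongr
          exact hlow t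
  · obtain ⟨b1, b2, b3⟩ := hball hw
    calc ‖entireXi w‖ ≤ Real.exp (A * (1 + |w.im|)) := hup w (by linarith) b2.le
      _ ≤ Real.exp ((4 * A + A') * (1 + |t|) + -(A' * (1 + |t|))) := by
          gcongr
          nlinarith
      _ = Real.exp ((4 * A + A') * (1 + |t|)) * Real.exp (-(A' * (1 + |t|))) := Real.exp_add _ _
      _ ≤ _ := by
          gcongr
          exact hlow t

lemma Complex.norm_le_norm_add_ofReal {z : ℂ} (hz : 0 ≤ z.re) {a : ℝ} (ha : 0 ≤ a) :
    ‖z‖ ≤ ‖z + a‖ := by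
  rw [← sq_le_sq₀ (norm_nonneg _) (norm_nonneg _), Complex.sq_norm, Complex.sq_norm,
    Complex.normSq_apply, Complex.normSq_apply]
  simp
  nlinarith

lemma exists_norm_entireXi_le_mul_norm_entireXi_add {h : ℝ} (hh : 0 < h) :
    ∃ C, ∀ s : ℂ, 3 ≤ s.re → ‖entireXi s‖ ≤ C * ‖entireXi (s + (2 * h : ℝ))‖ := by
  obtain ⟨K, hK, hζ⟩ := exists_norm_riemannZeta_le
  have hG := Real.Gamma_pos_of_pos hh
  refine ⟨Real.pi ^ h * (1 / h / Real.Gamma h) * (K * K), fun s hs ↦ ?_⟩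
  set w : ℂ := s + (2 * h : ℝ) with hw
  have hwre : w.re = s.re + 2 * h := by simp [hw]
  have hne {z : ℂ} (hz : 3 ≤ z.re) : z ≠ 1 := by
    rintro rfl
    norm_num at hz
  have hw3 : 3 ≤ w.re := by linarith
  rw [entireXi_eq_mul_riemannZeta (by linarith) (hne hs),
    entireXi_eq_mul_riemannZeta (by linarith) (hne hw3)]
  have hpoly : ‖s * (s - 1) / 2‖ ≤ ‖w * (w - 1) / 2‖ := by
    have h1 : ‖s‖ ≤ ‖w‖ := Complex.norm_le_norm_add_ofReal (by linarith) (by linarith)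
    have h2 : ‖s - 1‖ ≤ ‖w - 1‖ := by
      have := Complex.norm_le_norm_add_ofReal (z := s - 1) (a := 2 * h)
        (by rw [Complex.sub_re, Complex.one_re]; linarith) (by linarith)
      rwa [sub_add_eq_add_sub] at this
    rw [norm_div, norm_mul, norm_div, norm_mul]
    gcongr
  have hgam : ‖Gammaℝ s‖ ≤ Real.pi ^ h * (1 / h / Real.Gamma h) * ‖Gammaℝ w‖ := by
    have e1 : w / 2 = s / 2 + h := by rw [hw]; push_cast; ring
    have hp : ‖(Real.pi : ℂ) ^ (-s / 2)‖ = Real.pi ^ h * ‖(Real.pi : ℂ) ^ (-w / 2)‖ := by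
      rw [Complex.norm_cpow_eq_rpow_re_of_pos Real.pi_pos,
        Complex.norm_cpow_eq_rpow_re_of_pos Real.pi_pos, ← Real.rpow_add Real.pi_pos]
      congr 1
      simp [hwre]
      ring
    rw [Gammaℝ_def, Gammaℝ_def, norm_mul, norm_mul, hp, e1]
    have := norm_Gamma_le_mul_norm_Gamma_add hh (z := s / 2) (by simp; linarith)
    calc _ ≤ Real.pi ^ h * ‖(Real.pi : ℂ) ^ (-w / 2)‖ *
          (1 / h / Real.Gamma h * ‖Gamma (s / 2 + h)‖) := by gcongr
      _ = _ := by ring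
  have hzeta : ‖riemannZeta s‖ ≤ K * K * ‖riemannZeta w‖ := by
    have h1 := (hζ s (by linarith)).1
    have h2 := (hζ w (by linarith)).2
    have h0 := norm_pos_iff.mpr (riemannZeta_ne_zero_of_one_le_re (s := w) (by linarith))
    rw [norm_inv, inv_le_iff_one_le_mul₀ h0] at h2
    calc ‖riemannZeta s‖ ≤ K := h1
      _ ≤ K * (K * ‖riemannZeta w‖) := le_mul_of_one_le_right hK.le h2
      _ = _ := by ring
  rw [norm_mul, norm_mul, norm_mul, norm_mul]
  calc _ ≤ ‖w * (w - 1) / 2‖ * (Real.pi ^ h * (1 / h / Real.Gamma h) * ‖Gammaℝ w‖ *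
        (K * K * ‖riemannZeta w‖)) := by gcongr
    _ = _ := by ring

/-! ### Monotonicity of `|ξ|` to the right of the critical line -/

lemma norm_entireXi_sub_le_norm_entireXi_add (hRH : RiemannHypothesis) {h : ℝ} (hh : 0 < h)
    (hh4 : h ≤ 1 / 4) {s : ℂ} (hs : 1 / 2 ≤ s.re) :
    ‖entireXi (s - h)‖ ≤ ‖entireXi (s + h)‖ := by
  obtain ⟨A, hA, hup⟩ := exists_norm_entireXi_le
  obtain ⟨D, hlow⟩ := exists_exp_neg_le_norm_entireXi hRH hh (by linarith)
  obtain ⟨C, hfar⟩ := exists_norm_entireXi_le_mul_norm_entireXi_add hh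
  have hne {z : ℂ} (hz : 0 ≤ z.re) : entireXi (1 / 2 + z + h) ≠ 0 :=
    entireXi_ne_zero_of_one_half_lt_re hRH (by simp; linarith)
  set F : ℂ → ℂ := fun z ↦ entireXi (1 / 2 + z - h) / entireXi (1 / 2 + z + h) with hF
  have hFd : DifferentiableOn ℂ F {z | 0 ≤ z.re} := by
    have := differentiable_entireXi
    refine DifferentiableOn.div (by fun_prop) (by fun_prop) fun z hz ↦ hne hz
  have hright {z : ℂ} (hz : 3 ≤ z.re) : ‖F z‖ ≤ C := by
    rw [norm_div, div_le_iff₀ (norm_pos_iff.mpr (hne (by linarith)))]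
    have := hfar (1 / 2 + z - h) (by simp; linarith)
    have e : 1 / 2 + z - h + (2 * h : ℝ) = 1 / 2 + z + h := by push_cast; ring
    rwa [e] at this
  have hstrip {z : ℂ} (hz0 : 0 ≤ z.re) (hz : z.re ≤ 3) :
      ‖F z‖ ≤ Real.exp ((A + D) * (1 + |z.im|)) := by
    rw [norm_div, div_le_iff₀ (norm_pos_iff.mpr (hne hz0))]
    have h1 := hup (1 / 2 + z - h) (by simp; linarith) (by simp; linarith)
    have h2 := hlow (1 / 2 + z + h) (by simp; linarith) (by simp; linarith)
    have e1 : (1 / 2 + z - h).im = z.im := by simp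
    have e2 : (1 / 2 + z + h).im = z.im := by simp
    rw [e1] at h1
    rw [e2] at h2
    calc _ ≤ _ := h1
      _ = Real.exp ((A + D) * (1 + |z.im|)) * Real.exp (-(D * (1 + |z.im|))) := by
        rw [← Real.exp_add]
        congr 1
        ring
      _ ≤ _ := by gcongr
  have hC : 0 ≤ C := (norm_nonneg _).trans (hright (z := 3) (by simp))
  have hgrowth {z : ℂ} (hz0 : 0 ≤ z.re) :
      ‖F z‖ ≤ (C + Real.exp |A + D|) * Real.exp (|A + D| * ‖z‖) := by
    have h1 : 1 ≤ Real.exp (|A + D| * ‖z‖) := Real.one_le_exp (by positivity)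
    rcases le_total z.re 3 with h3 | h3
    · calc _ ≤ _ := hstrip hz0 h3
        _ ≤ Real.exp (|A + D| * (1 + ‖z‖)) := by
          have := le_abs_self (A + D)
          have := Complex.abs_im_le_norm z
          gcongr
        _ = Real.exp |A + D| * Real.exp (|A + D| * ‖z‖) := by
          rw [← Real.exp_add]
          congr 1
          ring
        _ ≤ _ := by
          gcongr
          linarith
    · calc _ ≤ C := hright h3
        _ ≤ C + Real.exp |A + D| := le_add_of_nonneg_right (Real.exp_pos _).le
        _ ≤ _ := le_mul_of_one_le_right (by positivity) h1
  have hFd' : DiffContOnCl ℂ F {z | 0 < z.re} := by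
    refine ⟨hFd.mono fun z (hz : 0 < z.re) ↦ hz.le, ?_⟩
    rw [Complex.closure_setOfPred_lt_re]
    exact hFd.continuousOn
  have hFs : ‖F (s - 1 / 2)‖ ≤ 1 := by
    refine PhragmenLindelof.right_half_plane_of_bounded_on_real hFd'
      ⟨1, one_lt_two, |A + D|, ?_⟩ ?_ (fun x ↦ ?_) (by simp; linarith)
    · refine Asymptotics.IsBigO.of_bound (C + Real.exp |A + D|) ?_
      refine (eventually_principal.mpr ?_).filter_mono inf_le_right
      intro z (hz : 0 < z.re)
      simpa using hgrowth hz.le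
    · refine ⟨C, ?_⟩
      rw [eventually_map]
      filter_upwards [eventually_ge_atTop 3] with x hx
      exact hright (by simpa using hx)
    · rw [norm_div, div_le_one (norm_pos_iff.mpr (hne (by simp)))]
      have e : 1 / 2 + x * I - h = 1 - conj (1 / 2 + x * I + h) := by
        simp [map_ofNat]
        ring
      rw [e, entireXi_one_sub_conj (by simp; linarith), RCLike.norm_conj]
  rw [norm_div, div_le_one (norm_pos_iff.mpr (hne (by simp; linarith)))] at hFs
  simpa using hFs

lemma re_conj_entireXi_mul_deriv_nonneg (hRH : RiemannHypothesis) {s : ℂ} (hs : 1 / 2 ≤ s.re) :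
    0 ≤ (conj (entireXi s) * deriv entireXi s).re := by
  have hd := (differentiable_entireXi s).hasDerivAt
  have hadd : HasDerivAt (fun x : ℝ ↦ entireXi (s + x)) (deriv entireXi s) 0 := by
    have h1 : HasDerivAt (fun x : ℝ ↦ s + x) 1 0 := Complex.ofRealCLM.hasDerivAt.const_add s
    have h2 : HasDerivAt entireXi (deriv entireXi s) (s + ((0 : ℝ) : ℂ)) := by simpa using hd
    have h3 := h2.comp (0 : ℝ) h1
    rwa [mul_one] at h3
  have hsub : HasDerivAt (fun x : ℝ ↦ entireXi (s - x)) (-deriv entireXi s) 0 := by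
    have h1 : HasDerivAt (fun x : ℝ ↦ s - x) (-1) 0 := Complex.ofRealCLM.hasDerivAt.const_sub s
    have h2 : HasDerivAt entireXi (deriv entireXi s) (s - ((0 : ℝ) : ℂ)) := by simpa using hd
    have h3 := h2.comp (0 : ℝ) h1
    rwa [mul_neg_one] at h3
  have hφ := (hadd.norm_sq.sub hsub.norm_sq).tendsto_slope_zero_right
  have hnonneg := ge_of_tendsto hφ (b := 0) ?_
  · simp only [Complex.ofReal_zero, add_zero, sub_zero, Complex.inner] at hnonneg
    simp at hnonneg ⊢
    linarith
  · have hmem : Set.Ioo (0 : ℝ) (1 / 4) ∈ 𝓝[>] (0 : ℝ) := Ioo_mem_nhdsGT (by norm_num)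
    filter_upwards [hmem] with x hx
    have h1 := norm_entireXi_sub_le_norm_entireXi_add hRH hx.1 hx.2.le hs
    have h2 : ‖entireXi (s - x)‖ ^ 2 ≤ ‖entireXi (s + x)‖ ^ 2 := by gcongr
    have h3 : 0 ≤ x⁻¹ := inv_nonneg.mpr hx.1.le
    simp only [zero_add, Complex.ofReal_zero, add_zero, sub_zero, sub_self, smul_eq_mul,
      Pi.sub_apply]
    exact mul_nonneg h3 (by linarith)

/-! ### Zeros of functions with nonnegative real part on a half disc -/

lemma re_deriv_pos_of_re_nonneg_on_half_disc {G : ℂ → ℂ} {z₀ : ℂ} (hG : AnalyticAt ℂ G z₀)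
    (hG0 : G z₀ = 0) (hne : ¬∀ᶠ z in 𝓝 z₀, G z = 0)
    (hre : ∀ᶠ z in 𝓝 z₀, z₀.re ≤ z.re → 0 ≤ (G z).re) : 0 < (deriv G z₀).re := by
  obtain ⟨n, g, hg, hg0, heq⟩ := hG.exists_eventuallyEq_pow_smul_nonzero_iff.mpr hne
  have hn : n ≠ 0 := by
    rintro rfl
    have := heq.self_of_nhds
    simp [hG0] at this
    exact hg0 this.symm
  have hdir (u : ℂ) (hu : 0 ≤ u.re) : 0 ≤ (u ^ n * g z₀).re := by
    have hline : Tendsto (fun r : ℝ ↦ z₀ + r * u) (𝓝[>] 0) (𝓝 z₀) := by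
      have : Continuous fun r : ℝ ↦ z₀ + r * u := by fun_prop
      exact (this.tendsto' 0 z₀ (by simp)).mono_left nhdsWithin_le_nhds
    have hlim : Tendsto (fun r : ℝ ↦ (u ^ n * g (z₀ + r * u)).re) (𝓝[>] 0)
        (𝓝 (u ^ n * g z₀).re) :=
      (Complex.continuous_re.tendsto _).comp
        ((hg.continuousAt.tendsto.comp hline).const_mul (u ^ n))
    refine ge_of_tendsto hlim ?_
    filter_upwards [hline.eventually heq, hline.eventually hre, self_mem_nhdsWithin]
      with r h1 h2 (hr : 0 < r)
    have h3 := h2 (by simp; positivity)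
    have e : (z₀ + r * u - z₀) ^ n • g (z₀ + r * u) =
        ((r ^ n : ℝ) : ℂ) * (u ^ n * g (z₀ + r * u)) := by
      push_cast
      rw [smul_eq_mul]
      ring
    rw [h1, e, Complex.re_ofReal_mul] at h3
    exact nonneg_of_mul_nonneg_right h3 (pow_pos hr n)
  have hn1 : n = 1 := by
    by_contra hn1
    have hn2 : (2 : ℝ) ≤ n := by
      have : 2 ≤ n := by omega
      exact_mod_cast this
    set x : ℂ := -conj (g z₀) with hx
    have hx0 : x ≠ 0 := by simpa [hx] using hg0
    have hroot : (x ^ (n⁻¹ : ℂ)) ^ n = x := Complex.cpow_nat_inv_pow x hn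
    have hroot_re : 0 ≤ (x ^ (n⁻¹ : ℂ)).re := by
      have him : (Complex.log x * (n⁻¹ : ℂ)).im = x.arg / n := by
        have : (n⁻¹ : ℂ) = ((n⁻¹ : ℝ) : ℂ) := by push_cast; rfl
        rw [this, Complex.im_mul_ofReal, Complex.log_im, div_eq_mul_inv]
      rw [Complex.cpow_def_of_ne_zero hx0, Complex.exp_re, him]
      refine mul_nonneg (Real.exp_pos _).le (Real.cos_nonneg_of_neg_pi_div_two_le_of_le ?_ ?_)
      · rw [le_div_iff₀ (by linarith)]
        nlinarith [Complex.neg_pi_lt_arg x, Real.pi_pos]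
      · rw [div_le_iff₀ (by linarith)]
        nlinarith [Complex.arg_le_pi x, Real.pi_pos]
    have h := hdir _ hroot_re
    rw [hroot, hx, neg_mul, ← Complex.normSq_eq_conj_mul_self, Complex.neg_re,
      Complex.ofReal_re] at h
    linarith [Complex.normSq_pos.mpr hg0]
  subst hn1
  have hderiv : deriv G z₀ = g z₀ := by
    rw [Filter.EventuallyEq.deriv_eq heq]
    have h1 := ((hasDerivAt_id z₀).sub_const z₀).mul hg.differentiableAt.hasDerivAt
    have h2 : (fun z ↦ (z - z₀) ^ 1 • g z) = (fun z ↦ id z - z₀) * g := by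
      ext z
      simp
    rw [h2, h1.deriv]
    simp
  have h1 := hdir 1 (by simp)
  have h2 := hdir I (by simp)
  have h3 := hdir (-I) (by simp)
  simp at h1 h2 h3
  rw [hderiv]
  refine lt_of_le_of_ne h1 fun h ↦ hg0 (Complex.ext h.symm ?_)
  rw [Complex.zero_im]
  linarith

lemma not_eventually_deriv_entireXi_eq_zero (s : ℂ) : ¬∀ᶠ z in 𝓝 s, deriv entireXi z = 0 := by
  intro h
  have han : AnalyticOnNhd ℂ (deriv entireXi) Set.univ :=
    fun z _ ↦ (differentiable_entireXi.analyticAt z).deriv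
  have hzero := han.eqOn_zero_of_preconnected_of_eventuallyEq_zero isPreconnected_univ
    (Set.mem_univ s) h
  have hconst := is_const_of_deriv_eq_zero differentiable_entireXi
    (fun z ↦ hzero (Set.mem_univ z)) 2 0
  rw [entireXi_two, entireXi_zero] at hconst
  have hcast : ((Real.pi / 6 : ℝ) : ℂ) = ((1 / 2 : ℝ) : ℂ) := by
    push_cast
    exact hconst
  have hreal : Real.pi / 6 = 1 / 2 := Complex.ofReal_injective hcast
  linarith [Real.pi_gt_three]

/-! ### The restriction to the critical line -/

lemma entireXi_one_half_add_mul_I (t : ℝ) : entireXi (1 / 2 + t * I) = Xi t := by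
  have hre : (1 / 2 + t * I : ℂ).re = 1 / 2 := by simp
  have hconj := entireXi_one_sub_conj (s := 1 / 2 + t * I) (by rw [hre]; norm_num)
  have e : 1 - conj (1 / 2 + t * I : ℂ) = 1 / 2 + t * I := by
    simp [map_ofNat]
    ring
  rw [e] at hconj
  have h0 : (1 / 2 + t * I : ℂ) ≠ 0 := by
    intro h
    rw [h] at hre
    norm_num at hre
  have h1 : (1 / 2 + t * I : ℂ) ≠ 1 := by
    intro h
    rw [h] at hre
    norm_num at hre
  rw [Xi, ← entireXi_eq_xi h0 h1]
  exact (Complex.conj_eq_iff_re.mp hconj.symm).symm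

lemma hasDerivAt_comp_one_half_add_mul_I {f : ℂ → ℂ} (hf : Differentiable ℂ f) (t : ℝ) :
    HasDerivAt (fun t : ℝ ↦ f (1 / 2 + t * I)) (deriv f (1 / 2 + t * I) * I) t := by
  have h1 : HasDerivAt (fun t : ℝ ↦ (1 / 2 + t * I : ℂ)) I t := by
    simpa using (Complex.ofRealCLM.hasDerivAt (x := t)).mul_const I |>.const_add (1 / 2)
  exact (hf (1 / 2 + t * I)).hasDerivAt.comp t h1

lemma ofReal_deriv_Xi (t : ℝ) : ((deriv Xi t : ℝ) : ℂ) = deriv entireXi (1 / 2 + t * I) * I := by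
  have h1 := hasDerivAt_comp_one_half_add_mul_I differentiable_entireXi t
  simp only [entireXi_one_half_add_mul_I] at h1
  have h2 : HasDerivAt Xi (deriv entireXi (1 / 2 + t * I) * I).re t := by
    simpa only [Complex.reCLM_apply, Function.comp_def, Complex.ofReal_re] using
      (Complex.reCLM.hasFDerivAt.comp_hasDerivAt t h1)
  rw [h2.deriv]
  have h3 : HasDerivAt (fun t ↦ (Xi t : ℂ)) ((deriv entireXi (1 / 2 + t * I) * I).re : ℂ) t :=
    h2.ofReal_comp
  exact h3.unique h1

lemma ofReal_deriv_deriv_Xi (t : ℝ) :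
    ((deriv (deriv Xi) t : ℝ) : ℂ) = -deriv (deriv entireXi) (1 / 2 + t * I) := by
  have hd : Differentiable ℂ (deriv entireXi) :=
    fun z ↦ ((differentiable_entireXi.analyticAt z).deriv).differentiableAt
  have h1 := (hasDerivAt_comp_one_half_add_mul_I hd t).mul_const I
  simp only [← ofReal_deriv_Xi] at h1
  have h2 : HasDerivAt (deriv Xi) (deriv (deriv entireXi) (1 / 2 + t * I) * I * I).re t := by
    simpa only [Complex.reCLM_apply, Function.comp_def, Complex.ofReal_re] using
      (Complex.reCLM.hasFDerivAt.comp_hasDerivAt t h1)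
  rw [h2.deriv, h2.ofReal_comp.unique h1, mul_assoc, Complex.I_mul_I, mul_neg_one]

/-- Assuming RH, at every critical point `t*` of `Ξ` with `Ξ(t*) ≠ 0` one has
`Ξ''(t*)·Ξ(t*) < 0`. -/
theorem xi_second_deriv_mul_neg_at_critical_points (hRH : RiemannHypothesis)
    (tstar : ℝ) (hcrit : deriv Xi tstar = 0) (hne : Xi tstar ≠ 0) :
    deriv (deriv Xi) tstar * Xi tstar < 0 := by
  set s₀ : ℂ := 1 / 2 + tstar * I with hs₀
  have hs₀re : s₀.re = 1 / 2 := by simp [hs₀]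
  have hval : entireXi s₀ = Xi tstar := entireXi_one_half_add_mul_I tstar
  have hval0 : entireXi s₀ ≠ 0 := by
    rw [hval]
    exact_mod_cast hne
  have hderiv : deriv entireXi s₀ = 0 := by
    have := ofReal_deriv_Xi tstar
    rw [hcrit, Complex.ofReal_zero] at this
    exact (mul_eq_zero.mp this.symm).resolve_right Complex.I_ne_zero
  have hsecond : deriv (deriv entireXi) s₀ = -((deriv (deriv Xi) tstar : ℝ) : ℂ) := by
    rw [ofReal_deriv_deriv_Xi, neg_neg]
  have han := differentiable_entireXi.analyticAt s₀
  have hev : ∀ᶠ z in 𝓝 s₀, entireXi z ≠ 0 := han.continuousAt.eventually_ne hval0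
  have hpos := re_deriv_pos_of_re_nonneg_on_half_disc
    (G := fun z ↦ deriv entireXi z / entireXi z) (z₀ := s₀) (han.deriv.div han hval0)
    (by simp [hderiv]) (fun h ↦ ?_) (Eventually.of_forall fun z hz ↦ ?_)
  · have hG : deriv (fun z ↦ deriv entireXi z / entireXi z) s₀ =
        ((-deriv (deriv Xi) tstar / Xi tstar : ℝ) : ℂ) := by
      have := (han.deriv.differentiableAt.hasDerivAt.div
        han.differentiableAt.hasDerivAt hval0).deriv
      refine this.trans ?_
      rw [hderiv, mul_zero, sub_zero, pow_two, mul_div_mul_right _ _ hval0, hsecond, hval]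
      push_cast
      rfl
    rw [hG, Complex.ofReal_re, neg_div, neg_pos] at hpos
    have h2 : 0 < Xi tstar ^ 2 := by positivity
    calc deriv (deriv Xi) tstar * Xi tstar
        = deriv (deriv Xi) tstar / Xi tstar * Xi tstar ^ 2 := by field_simp
      _ < 0 := mul_neg_of_neg_of_pos hpos h2
  · refine not_eventually_deriv_entireXi_eq_zero s₀ ?_
    filter_upwards [h, hev] with z h1 h2
    exact (div_eq_zero_iff.mp h1).resolve_right h2
  · have h := re_conj_entireXi_mul_deriv_nonneg hRH (s := z) (by linarith)
    have e : deriv entireXi z / entireXi z =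
        ((Complex.normSq (entireXi z))⁻¹ : ℝ) * (conj (entireXi z) * deriv entireXi z) := by
      rw [div_eq_mul_inv, Complex.inv_def]
      push_cast
      ring
    rw [e, Complex.re_ofReal_mul]
    exact mul_nonneg (inv_nonneg.mpr (Complex.normSq_nonneg _)) h
end

section
/- For every real t with t ∉ {t_n, −t_n : n ≥ 1}, the function F is differentiable at t, F(t) ≠ 0, and F'(t)/F(t) = 2·∑_{n≥1} t/(t² − t_n²), where the series converges absolutely. -/
open Filter in
lemma summable_abs_div_sq_sub_sq {a : ℕ → ℝ} (ha : ∀ n, 0 < a n)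
    (hsum : Summable fun n => 1 / a n ^ 2) (t : ℝ) :
    Summable fun n => |t / (t ^ 2 - a n ^ 2)| := by
  refine Summable.of_norm_bounded_eventually_nat (hsum.mul_left (2 * |t|)) ?_
  have hlim := hsum.tendsto_atTop_zero.const_mul (2 * t ^ 2)
  rw [mul_zero] at hlim
  filter_upwards [hlim.eventually_lt_const one_pos] with n hn
  have h2 : 0 < a n ^ 2 := pow_pos (ha n) 2
  have h3 : 2 * t ^ 2 < a n ^ 2 := by rwa [mul_one_div, div_lt_one h2] at hn
  have h4 : 0 < a n ^ 2 - t ^ 2 := by nlinarith [sq_nonneg t]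
  rw [Real.norm_eq_abs, abs_abs, abs_div, abs_sub_comm, abs_of_pos h4, mul_one_div,
    div_le_div_iff₀ h4 h2]
  nlinarith [mul_nonneg (abs_nonneg t) (sub_nonneg.2 h3.le)]

lemma Complex.multipliableLocallyUniformlyOn_one_sub_sq_add_div {a : ℕ → ℝ} (ha : ∀ n, 0 < a n)
    (hsum : Summable fun n => 1 / a n ^ 2) (R : ℝ) :
    MultipliableLocallyUniformlyOn
      (fun n (z : ℂ) => 1 + -(z ^ 2 + 1 / 4) / ((a n : ℂ) ^ 2 + 1 / 4)) (Metric.ball 0 R) := by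
  refine Summable.multipliableLocallyUniformlyOn_nat_one_add Metric.isOpen_ball
    (hsum.mul_left (R ^ 2 + 1 / 4)) (.of_forall fun n z hz => ?_) fun n => by fun_prop
  have hz' : ‖z‖ < R := by simpa using hz
  have h2 : 0 < a n ^ 2 := pow_pos (ha n) 2
  have hden : ‖(a n : ℂ) ^ 2 + 1 / 4‖ = a n ^ 2 + 1 / 4 := by
    rw [show (a n : ℂ) ^ 2 + 1 / 4 = ((a n ^ 2 + 1 / 4 : ℝ) : ℂ) by push_cast; ring,
      Complex.norm_real, Real.norm_of_nonneg (by positivity)]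
  have hnum : ‖z ^ 2 + 1 / 4‖ ≤ R ^ 2 + 1 / 4 := by
    refine (norm_add_le _ _).trans (add_le_add ?_ (by norm_num))
    rw [norm_pow]
    gcongr
  rw [norm_div, norm_neg, hden, mul_one_div]
  gcongr
  linarith

/-- Let `(t_n)` be positive reals with `∑ 1/t_n² < ∞` and
`F(t) = (1/2)·∏' n, (t_n² − t²)/(t_n² + 1/4)`.  For `t` avoiding all `±t_n`,
`F` is differentiable at `t`, `F(t) ≠ 0`, the series `∑ t/(t² − t_n²)` converges
absolutely, and `F'(t)/F(t) = 2·∑' n, t/(t² − t_n²)`. -/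
theorem log_deriv_of_product (tseq : ℕ → ℝ) (hpos : ∀ n, 0 < tseq n)
    (hsum : Summable fun n => 1 / (tseq n) ^ 2)
    (F : ℝ → ℝ)
    (hF : ∀ t : ℝ, F t = (1 / 2) * ∏' n : ℕ, ((tseq n) ^ 2 - t ^ 2) / ((tseq n) ^ 2 + 1 / 4))
    (t : ℝ) (ht : ∀ n, t ≠ tseq n ∧ t ≠ -tseq n) :
    DifferentiableAt ℝ F t ∧ F t ≠ 0 ∧
    Summable (fun n => |t / (t ^ 2 - (tseq n) ^ 2)|) ∧
    deriv F t / F t = 2 * ∑' n : ℕ, t / (t ^ 2 - (tseq n) ^ 2) := by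
  have hS := summable_abs_div_sq_sub_sq hpos hsum t
  have hne (n : ℕ) : (tseq n) ^ 2 - t ^ 2 ≠ 0 := fun h =>
    (sq_eq_sq_iff_eq_or_eq_neg.1 (sub_eq_zero.1 h).symm).elim (ht n).1 (ht n).2
  have hden (n : ℕ) : (tseq n) ^ 2 + 1 / 4 ≠ 0 := by positivity
  have hdenC (n : ℕ) : (tseq n : ℂ) ^ 2 + 1 / 4 ≠ 0 := by
    simpa using Complex.ofReal_ne_zero.2 (hden n)
  set g : ℕ → ℂ → ℂ := fun n z => -(z ^ 2 + 1 / 4) / ((tseq n : ℂ) ^ 2 + 1 / 4) with hg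
  have hm (R : ℝ) : MultipliableLocallyUniformlyOn (fun n z => 1 + g n z) (Metric.ball 0 R) :=
    Complex.multipliableLocallyUniformlyOn_one_sub_sq_add_div hpos hsum R
  have hd (n : ℕ) : Differentiable ℂ fun z => 1 + g n z := by
    simp only [hg]
    fun_prop
  have hreal (n : ℕ) (x : ℝ) :
      1 + g n x = (((tseq n) ^ 2 - x ^ 2) / ((tseq n) ^ 2 + 1 / 4) : ℝ) := by
    simp only [hg]
    push_cast
    rw [eq_div_iff (hdenC n), add_mul, div_mul_cancel₀ _ (hdenC n)]
    ring
  have htmem : (t : ℂ) ∈ Metric.ball (0 : ℂ) (|t| + 1) := by simp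
  have hprod (x : ℝ) : ∏' n, (1 + g n x) =
      ((∏' n, ((tseq n) ^ 2 - x ^ 2) / ((tseq n) ^ 2 + 1 / 4) : ℝ) : ℂ) := by
    simp only [hreal]
    exact (Topology.IsClosedEmbedding.map_tprod (g := Complex.ofRealHom) _
      Complex.isometry_ofReal.isClosedEmbedding).symm
  have hgt : Summable fun n => ‖g n t‖ := by
    refine (hsum.mul_left (t ^ 2 + 1 / 4)).of_nonneg_of_le (fun n => norm_nonneg _) fun n => ?_
    have h2 : 0 < (tseq n) ^ 2 := pow_pos (hpos n) 2
    have : g n t = (-(t ^ 2 + 1 / 4) / ((tseq n) ^ 2 + 1 / 4) : ℝ) := by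
      simp only [hg]
      push_cast
      rfl
    rw [this, Complex.norm_real, norm_div, norm_neg, Real.norm_of_nonneg (by positivity),
      Real.norm_of_nonneg (by positivity), mul_one_div]
    gcongr
    linarith
  have hfne (n : ℕ) : 1 + g n t ≠ 0 := by
    rw [hreal]
    exact_mod_cast div_ne_zero (hne n) (hden n)
  have hPne : ∏' n, (1 + g n t) ≠ 0 := tprod_one_add_ne_zero_of_summable hfne hgt
  have hlog (n : ℕ) :
      logDeriv (fun z => 1 + g n z) t = ((2 * (t / (t ^ 2 - (tseq n) ^ 2)) : ℝ) : ℂ) := by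
    have hder : HasDerivAt (fun z => 1 + g n z) (-(2 * t) / ((tseq n : ℂ) ^ 2 + 1 / 4)) t := by
      convert! ((((hasDerivAt_id (t : ℂ)).pow 2).add_const (1 / 4)).neg.div_const
        ((tseq n : ℂ) ^ 2 + 1 / 4)).const_add 1 using 1
      simp
    rw [logDeriv_apply, hder.deriv, hreal]
    have h : -(2 * t) / ((tseq n) ^ 2 + 1 / 4) /
        (((tseq n) ^ 2 - t ^ 2) / ((tseq n) ^ 2 + 1 / 4)) = 2 * (t / (t ^ 2 - (tseq n) ^ 2)) := by
      rw [div_div_div_cancel_right₀ (hden n), neg_div, ← div_neg, neg_sub, mul_div_assoc]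
    rw [← h]
    push_cast
    rfl
  have hlogsum : Summable fun n => logDeriv (fun z => 1 + g n z) (t : ℂ) := by
    simp only [hlog]
    exact Complex.ofRealCLM.summable (hS.of_abs.mul_left 2)
  have key := logDeriv_tprod_eq_tsum Metric.isOpen_ball htmem hfne
    (fun n => (hd n).differentiableOn) hlogsum (hm _) hPne
  have hdiff : DifferentiableAt ℂ (fun z => ∏' n, (1 + g n z)) t :=
    ((hm (|t| + 1)).hasProdLocallyUniformlyOn.differentiableOn
      (.of_forall fun s => by
        simpa [Finset.prod_fn] using
          DifferentiableOn.finsetProd (fun n _ => (hd n).differentiableOn))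
      Metric.isOpen_ball).differentiableAt (Metric.isOpen_ball.mem_nhds htmem)
  simp only [hlog] at key
  rw [← Complex.ofReal_tsum, tsum_mul_left, logDeriv_apply, div_eq_iff hPne, hprod t,
    ← Complex.ofReal_mul] at key
  have hderF : HasDerivAt F
      (1 / 2 * (2 * (∑' n, t / (t ^ 2 - (tseq n) ^ 2)) *
        ∏' n, ((tseq n) ^ 2 - t ^ 2) / ((tseq n) ^ 2 + 1 / 4))) t := by
    have h := hdiff.hasDerivAt.real_of_complex.const_mul (1 / 2)
    simp only [key, hprod, Complex.ofReal_re] at h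
    rwa [← funext hF] at h
  have hFne : F t ≠ 0 := by
    rw [hprod, Complex.ofReal_ne_zero] at hPne
    rw [hF]
    exact mul_ne_zero (by norm_num) hPne
  refine ⟨hderF.differentiableAt, hFne, hS, ?_⟩
  rw [hderF.deriv, div_eq_iff hFne, hF]
  ring
end

section
/- For every real t with t ∉ {t_n, −t_n : n ≥ 1}, the function F is twice differentiable at t and F''(t)/F(t) − (F'(t)/F(t))² = −2·∑_{n≥1} (t² + t_n²)/(t² − t_n²)², and this quantity is strictly negative. -/
open Filter Topology

theorem exists_one_add_sq_le_mul_abs {a : ℕ → ℝ} (hpos : ∀ n, 0 < a n)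
    (hsum : Summable fun n => 1 / (a n) ^ 2) {t : ℝ} (ht : ∀ n, t ≠ a n ∧ t ≠ -a n) :
    ∃ C : ℝ, 0 < C ∧ ∀ n, 1 + (a n) ^ 2 ≤ C * |(a n) ^ 2 - t ^ 2| := by
  have hne : ∀ n, (a n) ^ 2 - t ^ 2 ≠ 0 := fun n h => by
    rcases sq_eq_sq_iff_eq_or_eq_neg.mp (sub_eq_zero.mp h).symm with h | h
    · exact (ht n).1 h
    · exact (ht n).2 h
  have h0 := hsum.tendsto_atTop_zero
  have hlim : Tendsto (fun n => |(1 / (a n) ^ 2 + 1) / (1 - t ^ 2 * (1 / (a n) ^ 2))|) atTop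
      (𝓝 |(0 + 1) / (1 - t ^ 2 * 0)|) :=
    ((h0.add_const 1).div ((h0.const_mul _).const_sub 1) (by simp)).abs
  obtain ⟨C, hC⟩ := hlim.bddAbove_range
  refine ⟨max C 1, by positivity, fun n => ?_⟩
  have h1 := (hC ⟨n, rfl⟩).trans (le_max_left C 1)
  have hn := hpos n
  have h2 : (1 / (a n) ^ 2 + 1) / (1 - t ^ 2 * (1 / (a n) ^ 2))
      = (1 + (a n) ^ 2) / ((a n) ^ 2 - t ^ 2) := by
    have h3 : 1 - t ^ 2 * (1 / (a n) ^ 2) = ((a n) ^ 2 - t ^ 2) / (a n) ^ 2 := by field_simp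
    rw [h3]
    have := hne n
    field_simp
  dsimp only at h1
  rw [h2, abs_div, abs_of_pos (by positivity : 0 < 1 + (a n) ^ 2),
    div_le_iff₀ (abs_pos.mpr (hne n))] at h1
  exact h1

theorem hasDerivAt_log_sub_sq_div {A B s : ℝ} (h : A - s ^ 2 ≠ 0) (hB : B ≠ 0) :
    HasDerivAt (fun x => Real.log ((A - x ^ 2) / B)) (-2 * s / (A - s ^ 2)) s := by
  have h1 : HasDerivAt (fun x : ℝ => (A - x ^ 2) / B) (-(2 * s) / B) s := by
    simpa using ((hasDerivAt_pow 2 s).const_sub A).div_const B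
  convert! h1.log (div_ne_zero h hB) using 1
  field_simp

theorem hasDerivAt_neg_two_mul_div_sub_sq {A s : ℝ} (h : A - s ^ 2 ≠ 0) :
    HasDerivAt (fun x => -2 * x / (A - x ^ 2)) (-2 * ((s ^ 2 + A) / (s ^ 2 - A) ^ 2)) s := by
  have h1 : HasDerivAt (fun x : ℝ => A - x ^ 2) (-(2 * s)) s := by
    simpa using (hasDerivAt_pow 2 s).const_sub A
  convert! ((hasDerivAt_id s).const_mul (-2)).div h1 h using 1
  have h2 : s ^ 2 - A ≠ 0 := by rwa [← neg_ne_zero, neg_sub]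
  simp only [id]
  rw [← neg_sub A, neg_sq]
  field_simp
  ring

theorem hasDerivAt_tsum_on_ball {f f' : ℕ → ℝ → ℝ} {u : ℕ → ℝ} {t ε : ℝ} (hε : 0 < ε)
    (hu : Summable u) (hf : ∀ n, ∀ s ∈ Metric.ball t ε, HasDerivAt (f n) (f' n s) s)
    (hb : ∀ n, ∀ s ∈ Metric.ball t ε, ‖f' n s‖ ≤ u n) (h0 : Summable fun n => f n t) :
    ∀ s ∈ Metric.ball t ε, (Summable fun n => f n s) ∧
      HasDerivAt (fun x => ∑' n, f n x) (∑' n, f' n s) s := fun _ hs =>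
  ⟨summable_of_summable_hasDerivAt_of_isPreconnected hu Metric.isOpen_ball
      (convex_ball t ε).isPreconnected hf hb (Metric.mem_ball_self hε) h0 hs,
    hasDerivAt_tsum_of_isPreconnected hu Metric.isOpen_ball
      (convex_ball t ε).isPreconnected hf hb (Metric.mem_ball_self hε) h0 hs⟩

theorem multipliable_and_tprod_ne_zero {a : ℕ → ℝ} (hpos : ∀ n, 0 < a n)
    (hsum : Summable fun n => 1 / (a n) ^ 2) {t : ℝ} (hne : ∀ n, (a n) ^ 2 - t ^ 2 ≠ 0) :
    (Multipliable fun n => ((a n) ^ 2 - t ^ 2) / ((a n) ^ 2 + 1 / 4)) ∧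
      ∏' n, ((a n) ^ 2 - t ^ 2) / ((a n) ^ 2 + 1 / 4) ≠ 0 := by
  have hfac : ∀ n, ((a n) ^ 2 - t ^ 2) / ((a n) ^ 2 + 1 / 4)
      = 1 + -((t ^ 2 + 1 / 4) / ((a n) ^ 2 + 1 / 4)) := fun n => by
    field_simp
    ring
  have hs : Summable fun n => -((t ^ 2 + 1 / 4) / ((a n) ^ 2 + 1 / 4)) := by
    refine .of_norm_bounded (hsum.mul_left (t ^ 2 + 1 / 4)) fun n => ?_
    have hn := hpos n
    rw [norm_neg, Real.norm_of_nonneg (by positivity), mul_one_div]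
    gcongr
    linarith
  have hfn : ∀ n, 1 + -((t ^ 2 + 1 / 4) / ((a n) ^ 2 + 1 / 4)) ≠ 0 := fun n => by
    have hn := hpos n
    rw [← hfac]
    exact div_ne_zero (hne n) (by positivity)
  simp_rw [hfac]
  exact ⟨Real.multipliable_one_add_of_summable hs, tprod_one_add_ne_zero_of_summable hfn hs.norm⟩

theorem deriv_deriv_of_eventuallyEq_mul_exp {F g g₁ : ℝ → ℝ} {c g₂ t : ℝ} (hc : c ≠ 0)
    (hF : ∀ᶠ s in 𝓝 t, F s = c * Real.exp (g s)) (hg : ∀ᶠ s in 𝓝 t, HasDerivAt g (g₁ s) s)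
    (hg₁ : HasDerivAt g₁ g₂ t) :
    DifferentiableAt ℝ F t ∧ DifferentiableAt ℝ (deriv F) t ∧
      deriv (deriv F) t / F t - (deriv F t / F t) ^ 2 = g₂ := by
  have hF' : ∀ᶠ s in 𝓝 t, HasDerivAt F (c * (Real.exp (g s) * g₁ s)) s := by
    filter_upwards [hF.eventually_nhds, hg] with s h1 h2
    exact (h2.exp.const_mul c).congr_of_eventuallyEq h1
  have hd : deriv F =ᶠ[𝓝 t] fun s => c * (Real.exp (g s) * g₁ s) :=
    hF'.mono fun s h => h.deriv
  have hF'' := ((hg.self_of_nhds.exp.mul hg₁).const_mul c).congr_of_eventuallyEq hd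
  refine ⟨hF'.self_of_nhds.differentiableAt, hF''.differentiableAt, ?_⟩
  rw [hF''.deriv, hF'.self_of_nhds.deriv, hF.self_of_nhds]
  have := Real.exp_ne_zero (g t)
  field_simp
  ring


/-- Let `(t_n)` be positive reals with `∑ 1/t_n² < ∞` and
`F(t) = (1/2)·∏' n, (t_n² − t²)/(t_n² + 1/4)`.  For `t` avoiding all `±t_n`,
`F` is twice differentiable at `t` and
`F''(t)/F(t) − (F'(t)/F(t))² = −2·∑' n, (t² + t_n²)/(t² − t_n²)² < 0`. -/
theorem second_log_deriv_of_product (tseq : ℕ → ℝ) (hpos : ∀ n, 0 < tseq n)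
    (hsum : Summable fun n => 1 / (tseq n) ^ 2)
    (F : ℝ → ℝ)
    (hF : ∀ t : ℝ, F t = (1 / 2) * ∏' n : ℕ, ((tseq n) ^ 2 - t ^ 2) / ((tseq n) ^ 2 + 1 / 4))
    (t : ℝ) (ht : ∀ n, t ≠ tseq n ∧ t ≠ -tseq n) :
    DifferentiableAt ℝ F t ∧ DifferentiableAt ℝ (deriv F) t ∧
    deriv (deriv F) t / F t - (deriv F t / F t) ^ 2
      = -2 * ∑' n : ℕ, (t ^ 2 + (tseq n) ^ 2) / (t ^ 2 - (tseq n) ^ 2) ^ 2 ∧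
    deriv (deriv F) t / F t - (deriv F t / F t) ^ 2 < 0 := by
  obtain ⟨C, hC, hCn⟩ := exists_one_add_sq_le_mul_abs hpos hsum ht
  obtain ⟨ε, hε, hball⟩ : ∃ ε > 0, ∀ s ∈ Metric.ball t ε,
      |s ^ 2 - t ^ 2| < 1 / (2 * C) ∧ |s| < |t| + 1 := by
    have h1 : Tendsto (fun s : ℝ => |s ^ 2 - t ^ 2|) (𝓝 t) (𝓝 |t ^ 2 - t ^ 2|) :=
      Continuous.tendsto (by fun_prop) t
    have h2 : Tendsto (fun s : ℝ => |s|) (𝓝 t) (𝓝 |t|) := continuous_abs.tendsto t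
    have h3 := (h1.eventually_lt_const (u := 1 / (2 * C)) (by simp [hC])).and
      (h2.eventually_lt_const (lt_add_one |t|))
    exact Metric.eventually_nhds_iff_ball.mp h3
  have htball := Metric.mem_ball_self (x := t) hε
  have hclose : ∀ n, ∀ s ∈ Metric.ball t ε,
      |s ^ 2 - t ^ 2| ≤ |tseq n ^ 2 - t ^ 2| / 2 := fun n s hs => by
    have h1 := (hball s hs).1
    have h2 := hCn n
    rw [lt_div_iff₀ (by positivity)] at h1
    have h3 : C * (2 * |s ^ 2 - t ^ 2|) ≤ C * |tseq n ^ 2 - t ^ 2| := by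
      nlinarith [sq_nonneg (tseq n)]
    linarith [le_of_mul_le_mul_left h3 hC]
  have hlow : ∀ n, ∀ s ∈ Metric.ball t ε,
      1 + tseq n ^ 2 ≤ 2 * C * |tseq n ^ 2 - s ^ 2| := fun n s hs => by
    have h1 := hclose n s hs
    have h2 := abs_sub_abs_le_abs_sub (tseq n ^ 2 - t ^ 2) (s ^ 2 - t ^ 2)
    rw [sub_sub_sub_cancel_right] at h2
    nlinarith [hCn n]
  have hne : ∀ n, ∀ s ∈ Metric.ball t ε, tseq n ^ 2 - s ^ 2 ≠ 0 := fun n s hs h => by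
    have h1 := hlow n s hs
    rw [h, abs_zero] at h1
    nlinarith [sq_nonneg (tseq n)]
  have hratio : ∀ n, ∀ s ∈ Metric.ball t ε,
      0 < (tseq n ^ 2 - s ^ 2) / (tseq n ^ 2 - t ^ 2) := fun n s hs => by
    have h1 := hclose n s hs
    rcases lt_or_gt_of_ne (hne n t htball) with h | h
    · rw [abs_of_neg h] at h1
      exact div_pos_of_neg_of_neg (by linarith [neg_abs_le (s ^ 2 - t ^ 2)]) h
    · rw [abs_of_pos h] at h1
      exact div_pos (by linarith [le_abs_self (s ^ 2 - t ^ 2)]) h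
  have hb₁ : ∀ n, ∀ s ∈ Metric.ball t ε,
      ‖-2 * s / (tseq n ^ 2 - s ^ 2)‖ ≤ 4 * C * (|t| + 1) * (1 / tseq n ^ 2) := fun n s hs => by
    have hn := hpos n
    have h1 := hlow n s hs
    have h2 := (hball s hs).2
    have h3 := abs_pos.mpr (hne n s hs)
    rw [mul_one_div, Real.norm_eq_abs, abs_div, abs_mul, abs_neg, abs_two,
      div_le_div_iff₀ h3 (by positivity)]
    calc 2 * |s| * tseq n ^ 2 ≤ 2 * (|t| + 1) * (2 * C * |tseq n ^ 2 - s ^ 2|) := by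
          gcongr
          linarith
      _ = _ := by ring
  have hb₂ : ∀ n, ∀ s ∈ Metric.ball t ε,
      ‖-2 * ((s ^ 2 + tseq n ^ 2) / (s ^ 2 - tseq n ^ 2) ^ 2)‖
        ≤ 8 * C ^ 2 * ((|t| + 1) ^ 2 + 1) * (1 / tseq n ^ 2) := fun n s hs => by
    have hn := hpos n
    have h1 := hlow n s hs
    have h2 := (hball s hs).2
    have h3 := abs_pos.mpr (hne n s hs)
    rw [norm_mul, norm_neg, Real.norm_two, Real.norm_of_nonneg (by positivity), mul_one_div,
      ← mul_div_assoc, ← neg_sub (tseq n ^ 2), neg_sq, ← sq_abs (tseq n ^ 2 - s ^ 2),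
      div_le_div_iff₀ (by positivity) (by positivity)]
    have h4 : s ^ 2 ≤ (|t| + 1) ^ 2 := by
      rw [← sq_abs]
      gcongr
    calc 2 * (s ^ 2 + tseq n ^ 2) * tseq n ^ 2
        ≤ 2 * ((|t| + 1) ^ 2 + 1) * (1 + tseq n ^ 2) ^ 2 := by
          have h5 : s ^ 2 + tseq n ^ 2 ≤ ((|t| + 1) ^ 2 + 1) * (1 + tseq n ^ 2) := by
            nlinarith [mul_nonneg (sq_nonneg (|t| + 1)) (sq_nonneg (tseq n))]
          calc _ ≤ 2 * (((|t| + 1) ^ 2 + 1) * (1 + tseq n ^ 2)) * (1 + tseq n ^ 2) := by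
                gcongr
                linarith
            _ = _ := by ring
      _ ≤ 2 * ((|t| + 1) ^ 2 + 1) * (2 * C * |tseq n ^ 2 - s ^ 2|) ^ 2 := by gcongr
      _ = _ := by ring
  have hlog := hasDerivAt_tsum_on_ball hε (hsum.mul_left _)
    (fun n s hs => hasDerivAt_log_sub_sq_div (hne n s hs) (hne n t htball)) hb₁
    (by simp [div_self (hne _ t htball)])
  have hlog' := hasDerivAt_tsum_on_ball hε (hsum.mul_left _)
    (fun n s hs => hasDerivAt_neg_two_mul_div_sub_sq (hne n s hs)) hb₂
    (.of_norm_bounded (hsum.mul_left _) fun n => hb₁ n t htball)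
  obtain ⟨hmul, hprod⟩ := multipliable_and_tprod_ne_zero hpos hsum fun n => hne n t htball
  have hFt : F t ≠ 0 := by
    rw [hF]
    exact mul_ne_zero (by norm_num) hprod
  have hFexp : ∀ s ∈ Metric.ball t ε, F s = F t * Real.exp
      (∑' n, Real.log ((tseq n ^ 2 - s ^ 2) / (tseq n ^ 2 - t ^ 2))) := fun s hs => by
    have h1 := hmul.hasProd.mul (hlog s hs).1.hasSum.rexp
    rw [hF s, hF t, mul_assoc, ← h1.tprod_eq]
    congr 1
    refine tprod_congr fun n => ?_
    have hn := hpos n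
    have := hne n t htball
    rw [Function.comp_apply, Real.exp_log (hratio n s hs)]
    field_simp
  have hnhds := Metric.ball_mem_nhds t hε
  obtain ⟨hd, hd', heq⟩ := deriv_deriv_of_eventuallyEq_mul_exp hFt
    (eventually_of_mem hnhds hFexp) (eventually_of_mem hnhds fun s hs => (hlog s hs).2)
    (hlog' t htball).2
  rw [tsum_mul_left] at heq
  refine ⟨hd, hd', heq, ?_⟩
  have hsummable : Summable fun n => (t ^ 2 + tseq n ^ 2) / (t ^ 2 - tseq n ^ 2) ^ 2 :=
    (summable_mul_left_iff (by norm_num : (-2 : ℝ) ≠ 0)).mp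
      (.of_norm_bounded (hsum.mul_left _) fun n => hb₂ n t htball)
  have hpos0 : 0 < (t ^ 2 + tseq 0 ^ 2) / (t ^ 2 - tseq 0 ^ 2) ^ 2 := by
    have h0 := hpos 0
    have h1 : t ^ 2 - tseq 0 ^ 2 ≠ 0 := by
      rw [← neg_ne_zero, neg_sub]
      exact hne 0 t htball
    positivity
  have := hsummable.tsum_pos (fun n => by positivity) 0 hpos0
  rw [heq]
  linarith
end

section
/- If t* is a real number with t* ∉ {t_n, −t_n : n ≥ 1} and F'(t*) = 0, then F''(t*)/F(t*) = −2·∑_{n≥1} (t*² + t_n²)/(t*² − t_n²)² < 0; consequently, if Ξ equals such a product F, every local maximum value of F is positive and every local minimum value is negative. -/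
open Filter Topology

/-- The second-order necessary condition at a local maximum. -/
theorem IsLocalMax.deriv_deriv_nonpos {f : ℝ → ℝ} {x : ℝ} (h : IsLocalMax f x)
    (hc : ContinuousAt f x) : deriv (deriv f) x ≤ 0 := by
  by_contra! hpos
  have hmin := isLocalMin_of_deriv_deriv_pos hpos h.deriv_eq_zero hc
  have hconst : f =ᶠ[𝓝 x] fun _ => f x := by
    filter_upwards [h, hmin] with t h₁ h₂ using le_antisymm h₁ h₂
  have := hconst.deriv.deriv_eq
  simp at this
  linarith

/-- The second-order necessary condition at a local minimum. -/
theorem IsLocalMin.deriv_deriv_nonneg {f : ℝ → ℝ} {x : ℝ} (h : IsLocalMin f x)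
    (hc : ContinuousAt f x) : 0 ≤ deriv (deriv f) x := by
  have := h.neg.deriv_deriv_nonpos hc.neg
  simpa using this

/-- If `a n → 0` and no `1 - a n * x ^ 2` vanishes, then these numbers stay away from `0` and keep
their signs, uniformly in `n`, as `x` varies in a small ball. -/
theorem exists_ball_le_abs_one_sub_mul_sq {a : ℕ → ℝ} (ha : Tendsto a atTop (𝓝 0)) {x : ℝ}
    (hx : ∀ n, 1 - a n * x ^ 2 ≠ 0) :
    ∃ δ > 0, ∃ c > 0, ∀ t ∈ Metric.ball x δ, ∀ n,
      c ≤ |1 - a n * t ^ 2| ∧ 0 < (1 - a n * t ^ 2) / (1 - a n * x ^ 2) := by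
  have hlim : Tendsto (fun n => |(1 - a n * x ^ 2)⁻¹|) atTop (𝓝 |(1 - 0 * x ^ 2)⁻¹|) :=
    ((tendsto_const_nhds.sub (ha.mul_const _)).inv₀ (by simp)).abs
  obtain ⟨B, hB⟩ := hlim.bddAbove_range
  obtain ⟨A, hA⟩ := ha.abs.bddAbove_range
  replace hB : ∀ n, |(1 - a n * x ^ 2)⁻¹| ≤ B := fun n => hB ⟨n, rfl⟩
  replace hA : ∀ n, |a n| ≤ A := fun n => hA ⟨n, rfl⟩
  have hB0 : 0 < B := (abs_pos.2 (inv_ne_zero (hx 0))).trans_le (hB 0)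
  have hcont : Tendsto (fun t : ℝ => A * |x ^ 2 - t ^ 2| * B) (𝓝 x)
      (𝓝 (A * |x ^ 2 - x ^ 2| * B)) := Continuous.tendsto (by fun_prop) x
  have hev := hcont.eventually_lt_const (show A * |x ^ 2 - x ^ 2| * B < 1 / 2 by norm_num)
  obtain ⟨δ, hδ, hball⟩ := Metric.eventually_nhds_iff_ball.1 hev
  refine ⟨δ, hδ, 1 / (2 * B), by positivity, fun t ht n => ?_⟩
  have hratio : 1 / 2 ≤ (1 - a n * t ^ 2) / (1 - a n * x ^ 2) := by
    have heq : (1 - a n * t ^ 2) / (1 - a n * x ^ 2)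
        = 1 + a n * (x ^ 2 - t ^ 2) * (1 - a n * x ^ 2)⁻¹ := by
      field_simp [hx n]
      ring
    have hle : |a n * (x ^ 2 - t ^ 2) * (1 - a n * x ^ 2)⁻¹| ≤ A * |x ^ 2 - t ^ 2| * B := by
      rw [abs_mul, abs_mul]
      have hA0 : 0 ≤ A := (abs_nonneg _).trans (hA 0)
      gcongr
      · exact hA n
      · exact hB n
    rw [heq]
    linarith [hball t ht, neg_abs_le (a n * (x ^ 2 - t ^ 2) * (1 - a n * x ^ 2)⁻¹)]
  refine ⟨?_, by linarith⟩
  have habs : 1 / 2 ≤ |1 - a n * t ^ 2| * |(1 - a n * x ^ 2)⁻¹| := by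
    rw [← abs_mul, ← div_eq_mul_inv]
    exact hratio.trans (le_abs_self _)
  rw [div_le_iff₀ (by positivity)]
  nlinarith [mul_le_mul_of_nonneg_left (hB n) (abs_nonneg (1 - a n * t ^ 2))]

theorem multipliable_one_sub_mul_sq {a : ℕ → ℝ} (hsum : Summable a) (t : ℝ) :
    Multipliable fun n => 1 - a n * t ^ 2 := by
  simpa only [sub_eq_add_neg] using
    Real.multipliable_one_add_of_summable (hsum.mul_right (t ^ 2)).neg

/-- Near a point where it does not vanish, `∏' n, (1 - a n * t ^ 2)` is differentiable; its
logarithmic derivative `g` is differentiable there and is differentiated termwise. -/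
theorem exists_logDeriv_tprod_one_sub_mul_sq {a : ℕ → ℝ} (ha : ∀ n, 0 ≤ a n) (hsum : Summable a)
    {x : ℝ} (hx : ∀ n, 1 - a n * x ^ 2 ≠ 0) :
    ∃ g : ℝ → ℝ,
      (∀ᶠ t in 𝓝 x, HasDerivAt (fun s => ∏' n, (1 - a n * s ^ 2))
        ((∏' n, (1 - a n * t ^ 2)) * g t) t) ∧
      (Summable fun n => -(2 * a n * (1 + a n * x ^ 2)) / (1 - a n * x ^ 2) ^ 2) ∧
      HasDerivAt g (∑' n, -(2 * a n * (1 + a n * x ^ 2)) / (1 - a n * x ^ 2) ^ 2) x := by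
  obtain ⟨δ, hδ, c, hc, hball⟩ := exists_ball_le_abs_one_sub_mul_sq hsum.tendsto_atTop_zero hx
  obtain ⟨A, hA⟩ := hsum.tendsto_atTop_zero.bddAbove_range
  replace hA : ∀ n, a n ≤ A := fun n => hA ⟨n, rfl⟩
  have hA0 : 0 ≤ A := (ha 0).trans (hA 0)
  set T := |x| + δ
  have hT : ∀ t ∈ Metric.ball x δ, |t| ≤ T := fun t ht => by
    have := abs_sub_abs_le_abs_sub t x
    rw [Metric.mem_ball, Real.dist_eq] at ht
    simp only [T]
    linarith
  have hne : ∀ t ∈ Metric.ball x δ, ∀ n, 1 - a n * t ^ 2 ≠ 0 := fun t ht n =>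
    abs_pos.1 (hc.trans_le (hball t ht n).1)
  have hopen : IsOpen (Metric.ball x δ) := Metric.isOpen_ball
  have hconn : IsPreconnected (Metric.ball x δ) := (convex_ball x δ).isPreconnected
  have hxmem : x ∈ Metric.ball x δ := Metric.mem_ball_self hδ
  have hinner : ∀ n t, HasDerivAt (fun s => 1 - a n * s ^ 2) (-(2 * a n * t)) t := fun n t => by
    convert! ((hasDerivAt_pow 2 t).const_mul (a n)).const_sub 1 using 1
    simp
    ring
  let L : ℕ → ℝ → ℝ := fun n t => Real.log ((1 - a n * t ^ 2) / (1 - a n * x ^ 2))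
  let L' : ℕ → ℝ → ℝ := fun n t => -(2 * a n * t) / (1 - a n * t ^ 2)
  let L'' : ℕ → ℝ → ℝ := fun n t => -(2 * a n * (1 + a n * t ^ 2)) / (1 - a n * t ^ 2) ^ 2
  have hL : ∀ n, ∀ t ∈ Metric.ball x δ, HasDerivAt (L n) (L' n t) t := fun n t ht => by
    convert! ((hinner n t).div_const (1 - a n * x ^ 2)).log (hball t ht n).2.ne' using 1
    have := hne t ht n
    have := hx n
    simp only [L']
    field_simp
  have hL' : ∀ n, ∀ t ∈ Metric.ball x δ, HasDerivAt (L' n) (L'' n t) t := fun n t ht => by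
    have hnum : HasDerivAt (fun s => -(2 * a n * s)) (-(2 * a n)) t := by
      simpa using! ((hasDerivAt_id t).const_mul (2 * a n)).neg
    convert! hnum.div (hinner n t) (hne t ht n) using 1
    simp only [L'']
    congr 1
    ring
  have hL'_le : ∀ n, ∀ t ∈ Metric.ball x δ, ‖L' n t‖ ≤ a n * (2 * T / c) := fun n t ht => by
    have h₁ := hT t ht
    have h₂ := (hball t ht n).1
    have h₃ := ha n
    have hle : 2 * a n * |t| / |1 - a n * t ^ 2| ≤ 2 * a n * T / c := by gcongr
    simp only [L', Real.norm_eq_abs, abs_div, abs_neg, abs_mul, abs_two, abs_of_nonneg h₃]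
    exact hle.trans_eq (by ring)
  have hL''_le : ∀ n, ∀ t ∈ Metric.ball x δ,
      ‖L'' n t‖ ≤ a n * (2 * (1 + A * T ^ 2) / c ^ 2) := fun n t ht => by
    have h₁ := hT t ht
    have h₂ := (hball t ht n).1
    have h₃ := ha n
    have h₄ := hA n
    have hle : 2 * a n * (1 + a n * |t| ^ 2) / |1 - a n * t ^ 2| ^ 2
        ≤ 2 * a n * (1 + A * T ^ 2) / c ^ 2 := by gcongr
    rw [sq_abs] at hle
    have hnn : 0 ≤ 2 * a n * (1 + a n * t ^ 2) := by positivity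
    simp only [L'', Real.norm_eq_abs, abs_div, abs_neg, abs_pow, abs_of_nonneg hnn]
    exact hle.trans_eq (by ring)
  have hLx : Summable fun n => L n x := by
    simp [L, summable_zero]
  have hLsum : ∀ t ∈ Metric.ball x δ, Summable fun n => L n t := fun t ht =>
    summable_of_summable_hasDerivAt_of_isPreconnected (hsum.mul_right _) hopen hconn hL hL'_le
      hxmem hLx ht
  have hG : ∀ t ∈ Metric.ball x δ, HasDerivAt (fun s => ∑' n, L n s) (∑' n, L' n t) t :=
    fun t ht => hasDerivAt_tsum_of_isPreconnected (hsum.mul_right _) hopen hconn hL hL'_le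
      hxmem hLx ht
  have hprod : ∀ t ∈ Metric.ball x δ,
      ∏' n, (1 - a n * t ^ 2) = (∏' n, (1 - a n * x ^ 2)) * Real.exp (∑' n, L n t) := by
    intro t ht
    have hmul := Real.hasProd_of_hasSum_log (fun n => (hball t ht n).2) (hLsum t ht).hasSum
    rw [← ((multipliable_one_sub_mul_sq hsum x).hasProd.mul hmul).tprod_eq]
    exact tprod_congr fun n => (mul_div_cancel₀ _ (hx n)).symm
  refine ⟨fun t => ∑' n, L' n t, ?_,
    .of_norm_bounded (hsum.mul_right _) fun n => hL''_le n x hxmem, ?_⟩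
  · filter_upwards [hopen.mem_nhds hxmem] with t ht
    have hexp := (hG t ht).exp.const_mul (∏' n, (1 - a n * x ^ 2))
    rw [← mul_assoc, ← hprod t ht] at hexp
    refine hexp.congr_of_eventuallyEq ?_
    filter_upwards [hopen.mem_nhds ht] with s hs using hprod s hs
  · have hL'x : Summable fun n => L' n x :=
      .of_norm_bounded (hsum.mul_right _) fun n => hL'_le n x hxmem
    exact hasDerivAt_tsum_of_isPreconnected (hsum.mul_right _) hopen hconn hL' hL''_le
      hxmem hL'x hxmem


/-- Let `(t_n)` be positive reals with `∑ 1/t_n² < ∞` and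
`F(t) = (1/2)·∏' n, (t_n² − t²)/(t_n² + 1/4)`.  If `t*` avoids all `±t_n` and
`F'(t*) = 0`, then `F''(t*)/F(t*) = −2·∑' n, (t*² + t_n²)/(t*² − t_n²)² < 0`;
consequently a local maximum value of `F` at such a point is positive and a
local minimum value is negative. -/
theorem second_deriv_ratio_neg_at_critical (tseq : ℕ → ℝ) (hpos : ∀ n, 0 < tseq n)
    (hsum : Summable fun n => 1 / (tseq n) ^ 2)
    (F : ℝ → ℝ)
    (hF : ∀ t : ℝ, F t = (1 / 2) * ∏' n : ℕ, ((tseq n) ^ 2 - t ^ 2) / ((tseq n) ^ 2 + 1 / 4))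
    (tstar : ℝ) (ht : ∀ n, tstar ≠ tseq n ∧ tstar ≠ -tseq n)
    (hcrit : deriv F tstar = 0) :
    deriv (deriv F) tstar / F tstar
      = -2 * ∑' n : ℕ, (tstar ^ 2 + (tseq n) ^ 2) / (tstar ^ 2 - (tseq n) ^ 2) ^ 2 ∧
    deriv (deriv F) tstar / F tstar < 0 ∧
    (IsLocalMax F tstar → 0 < F tstar) ∧
    (IsLocalMin F tstar → F tstar < 0) := by
  set a : ℕ → ℝ := fun n => 1 / tseq n ^ 2
  have ha : ∀ n, 0 < a n := fun n => by have := hpos n; simp only [a]; positivity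
  have hne : ∀ n, tstar ^ 2 - tseq n ^ 2 ≠ 0 := fun n h =>
    (sq_eq_sq_iff_eq_or_eq_neg.1 (sub_eq_zero.1 h)).elim (ht n).1 (ht n).2
  have hx : ∀ n, 1 - a n * tstar ^ 2 ≠ 0 := fun n h => hne n <| by
    have := (hpos n).ne'
    simp only [a] at h
    field_simp at h
    linarith
  have hb_pos : ∀ n, 0 < tseq n ^ 2 + 1 / 4 := fun n => by positivity
  have hb_sum : Summable fun n => -(1 / 4 / (tseq n ^ 2 + 1 / 4)) := by
    refine (hsum.of_nonneg_of_le (fun n => (div_pos (by norm_num) (hb_pos n)).le) fun n => ?_).neg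
    have := hpos n
    simp only [a]
    gcongr <;> norm_num
  have hb_mul := Real.multipliable_one_add_of_summable hb_sum
  obtain ⟨C, hC, hFC⟩ : ∃ C ≠ 0, F = fun t => C * ∏' n, (1 - a n * t ^ 2) := by
    refine ⟨1 / 2 * ∏' n, (1 + -(1 / 4 / (tseq n ^ 2 + 1 / 4))), mul_ne_zero (by norm_num) ?_, ?_⟩
    · refine tprod_one_add_ne_zero_of_summable (fun n => ?_) hb_sum.norm
      have hb := hb_pos n
      have heq : 1 + -(1 / 4 / (tseq n ^ 2 + 1 / 4)) = tseq n ^ 2 / (tseq n ^ 2 + 1 / 4) := by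
        field_simp
        ring
      rw [heq]
      exact (div_pos (pow_pos (hpos n) 2) hb).ne'
    · funext t
      rw [hF, mul_assoc, ← hb_mul.tprod_mul (multipliable_one_sub_mul_sq hsum t)]
      congr 1
      refine tprod_congr fun n => ?_
      have hb := (hb_pos n).ne'
      have := (hpos n).ne'
      simp only [a]
      field_simp
      ring
  have hF0 : F tstar ≠ 0 := by
    rw [hFC]
    refine mul_ne_zero hC ?_
    simp only [sub_eq_add_neg]
    exact tprod_one_add_ne_zero_of_summable
      (fun n => by simpa only [sub_eq_add_neg] using hx n) (hsum.mul_right _).neg.norm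
  obtain ⟨g, hP, hg_sum, hg⟩ := exists_logDeriv_tprod_one_sub_mul_sq (fun n => (ha n).le) hsum hx
  have hF' : ∀ᶠ t in 𝓝 tstar, HasDerivAt F (F t * g t) t := by
    filter_upwards [hP] with t h
    have := h.const_mul C
    rw [← mul_assoc] at this
    rwa [hFC]
  have hFd := hF'.self_of_nhds.differentiableAt
  have hF'' : deriv (deriv F) tstar =
      F tstar * ∑' n, -(2 * a n * (1 + a n * tstar ^ 2)) / (1 - a n * tstar ^ 2) ^ 2 := by
    have hev : deriv F =ᶠ[𝓝 tstar] fun t => F t * g t := by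
      filter_upwards [hF'] with t h using h.deriv
    rw [hev.deriv_eq, (hFd.hasDerivAt.fun_mul hg).deriv, hcrit, zero_mul, zero_add]
  have hterm : ∀ n, -(2 * a n * (1 + a n * tstar ^ 2)) / (1 - a n * tstar ^ 2) ^ 2
      = -2 * ((tstar ^ 2 + tseq n ^ 2) / (tstar ^ 2 - tseq n ^ 2) ^ 2) := fun n => by
    have h₁ := hne n
    have h₂ := (hpos n).ne'
    have h₃ : 1 - a n * tstar ^ 2 = -(tstar ^ 2 - tseq n ^ 2) / tseq n ^ 2 := by
      simp only [a]
      field_simp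
      ring
    rw [h₃]
    simp only [a]
    field_simp
    ring
  have hratio : deriv (deriv F) tstar / F tstar
      = -2 * ∑' n : ℕ, (tstar ^ 2 + (tseq n) ^ 2) / (tstar ^ 2 - (tseq n) ^ 2) ^ 2 := by
    rw [hF'', mul_div_cancel_left₀ _ hF0, tsum_congr hterm, tsum_mul_left]
  have hneg : deriv (deriv F) tstar / F tstar < 0 := by
    have hS : Summable fun n => (tstar ^ 2 + tseq n ^ 2) / (tstar ^ 2 - tseq n ^ 2) ^ 2 :=
      (summable_mul_left_iff (by norm_num)).1 (hg_sum.congr hterm)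
    have hS_pos : ∀ n, 0 < (tstar ^ 2 + tseq n ^ 2) / (tstar ^ 2 - tseq n ^ 2) ^ 2 := fun n =>
      div_pos (add_pos_of_nonneg_of_pos (sq_nonneg _) (pow_pos (hpos n) 2))
        (sq_pos_of_ne_zero (hne n))
    rw [hratio]
    linarith [hS.tsum_pos (fun n => (hS_pos n).le) 0 (hS_pos 0)]
  refine ⟨hratio, hneg, fun h => ?_, fun h => ?_⟩
  · by_contra! hle
    exact hneg.not_ge (div_nonneg_of_nonpos (h.deriv_deriv_nonpos hFd.continuousAt) hle)
  · by_contra! hle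
    exact hneg.not_ge (div_nonneg (h.deriv_deriv_nonneg hFd.continuousAt) hle)
end

section
/- Fix real constants λ > 0 and γ. For T > 0 large enough that the expressions below are defined, set t*(T) = √((1/3)(2T² + γ − 2λ² + √(T⁴ − 2(γ + 7λ²)T² + (λ² − γ)²))). Then T − t*(T) > 0 for all sufficiently large T and lim_{T→∞} T·(T − t*(T)) = 3λ²/2; in particular T − t*(T) → 0 as T → ∞. -/
open Filter

/-- The ratio `t*(T) / T` as a function of `u = T⁻²`. -/
noncomputable def extremumRatio (lam γ u : ℝ) : ℝ :=
  Real.sqrt ((1 / 3) * (2 + (γ - 2 * lam ^ 2) * u +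
    Real.sqrt (1 - 2 * (γ + 7 * lam ^ 2) * u + (lam ^ 2 - γ) ^ 2 * u ^ 2)))

lemma extremumRatio_zero (lam γ : ℝ) : extremumRatio lam γ 0 = 1 := by
  norm_num [extremumRatio]

lemma hasDerivAt_extremumRatio_zero (lam γ : ℝ) :
    HasDerivAt (extremumRatio lam γ) (-(3 * lam ^ 2 / 2)) 0 := by
  have h1 : HasDerivAt (fun u : ℝ => 1 - 2 * (γ + 7 * lam ^ 2) * u + (lam ^ 2 - γ) ^ 2 * u ^ 2)
      (-(2 * (γ + 7 * lam ^ 2))) 0 := by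
    refine ((((hasDerivAt_id (0 : ℝ)).const_mul (2 * (γ + 7 * lam ^ 2))).const_sub 1).add
      (((hasDerivAt_id (0 : ℝ)).pow 2).const_mul ((lam ^ 2 - γ) ^ 2))).congr_deriv ?_
    simp
  have h2 := h1.sqrt (by norm_num)
  have h3 : HasDerivAt (fun u : ℝ => 2 + (γ - 2 * lam ^ 2) * u) (γ - 2 * lam ^ 2) 0 := by
    refine (((hasDerivAt_id (0 : ℝ)).const_mul (γ - 2 * lam ^ 2)).const_add 2).congr_deriv ?_
    simp
  refine (((h3.add h2).const_mul (1 / 3)).sqrt (by norm_num)).congr_deriv ?_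
  norm_num
  ring

lemma sqrt_eq_mul_extremumRatio (lam γ : ℝ) {T : ℝ} (hT : 0 < T) :
    Real.sqrt ((1 / 3) * (2 * T ^ 2 + γ - 2 * lam ^ 2 +
      Real.sqrt (T ^ 4 - 2 * (γ + 7 * lam ^ 2) * T ^ 2 + (lam ^ 2 - γ) ^ 2))) =
      T * extremumRatio lam γ (T ^ 2)⁻¹ := by
  have inner_eq : Real.sqrt (T ^ 4 - 2 * (γ + 7 * lam ^ 2) * T ^ 2 + (lam ^ 2 - γ) ^ 2) =
      T ^ 2 * Real.sqrt (1 - 2 * (γ + 7 * lam ^ 2) * (T ^ 2)⁻¹ +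
        (lam ^ 2 - γ) ^ 2 * (T ^ 2)⁻¹ ^ 2) := by
    rw [← Real.sqrt_sq (sq_nonneg T), ← Real.sqrt_mul (sq_nonneg _), Real.sqrt_sq (sq_nonneg T)]
    congr 1
    field_simp
  rw [inner_eq, extremumRatio]
  conv_rhs => enter [1]; rw [← Real.sqrt_sq hT.le]
  rw [← Real.sqrt_mul (sq_nonneg _)]
  congr 1
  field_simp
  ring

/-- With `t*(T) = √((1/3)(2T² + γ − 2λ² + √(T⁴ − 2(γ+7λ²)T² + (λ²−γ)²)))`, one has
`T − t*(T) > 0` for all sufficiently large `T`, `T·(T − t*(T)) → 3λ²/2` as `T → ∞`,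
and in particular `T − t*(T) → 0`. -/
theorem extremum_shift_asymptotics (lam γ : ℝ) (hlam : 0 < lam) :
    let tstar : ℝ → ℝ := fun T => Real.sqrt ((1 / 3) * (2 * T ^ 2 + γ - 2 * lam ^ 2 +
      Real.sqrt (T ^ 4 - 2 * (γ + 7 * lam ^ 2) * T ^ 2 + (lam ^ 2 - γ) ^ 2)))
    (∀ᶠ T in atTop, 0 < T - tstar T) ∧
    Tendsto (fun T => T * (T - tstar T)) atTop (nhds (3 * lam ^ 2 / 2)) ∧
    Tendsto (fun T => T - tstar T) atTop (nhds 0) := by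
  intro tstar
  have hlim : Tendsto (fun T => T * (T - tstar T)) atTop (nhds (3 * lam ^ 2 / 2)) := by
    have hu : Tendsto (fun T : ℝ => (T ^ 2)⁻¹) atTop (nhdsWithin 0 (Set.Ioi 0)) :=
      tendsto_inv_atTop_nhdsGT_zero.comp (tendsto_pow_atTop two_ne_zero)
    have h := ((hasDerivAt_extremumRatio_zero lam γ).tendsto_slope_zero_right.comp hu).neg
    rw [neg_neg] at h
    refine h.congr' ?_
    filter_upwards [eventually_gt_atTop 0] with T hT
    have ht : tstar T = T * extremumRatio lam γ (T ^ 2)⁻¹ := sqrt_eq_mul_extremumRatio lam γ hT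
    simp only [Function.comp_apply, zero_add, extremumRatio_zero, inv_inv, smul_eq_mul, ht]
    ring
  refine ⟨?_, hlim, ?_⟩
  · filter_upwards [hlim.eventually_const_lt (by positivity : 0 < 3 * lam ^ 2 / 2),
      eventually_gt_atTop 0] with T h hT
    exact pos_of_mul_pos_right h hT.le
  · have h := tendsto_inv_atTop_zero.mul hlim
    rw [zero_mul] at h
    refine h.congr' ?_
    filter_upwards [eventually_gt_atTop 0] with T hT
    exact inv_mul_cancel_left₀ hT.ne' _
end
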